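/- Let R be a commutative ring and (A, D_G) a 1-tilting cotorsion pair with associated faithful finitely generated Gabriel topology G. Then the following are equivalent: (i) the class A is closed under direct limits; (ii) A is a covering class; (iii) R is G-almost perfect, i.e. the ring of quotients R_G is a perfect ring and R/J is a perfect ring for every J ∈ G. Moreover, if these equivalent conditions hold, then ψ_R : R → R_G is a perfect localisation and p.dim R_G ≤ 1. -/

import Mathlib

universe u

/-- A Gabriel topology on a commutative ring `R`: a filter of ideals of `R`
satisfying the Gabriel axiom T4. -/
structure GabrielTopology (R : Type u) [CommRing R] : Type u where
  sets : Set (Ideal R)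
  top_mem : (⊤ : Ideal R) ∈ sets
  mem_of_le : ∀ {I J : Ideal R}, I ∈ sets → I ≤ J → J ∈ sets
  inf_mem : ∀ {I J : Ideal R}, I ∈ sets → J ∈ sets → I ⊓ J ∈ sets
  gabriel : ∀ I J : Ideal R, J ∈ sets →
    (∀ r ∈ J, Submodule.colon I (Ideal.span {r}) ∈ sets) → I ∈ sets

namespace GabrielTopology

variable {R : Type u} [CommRing R] (G : GabrielTopology R)

/-- A module `M` is `G`-torsion if the annihilator of every element belongs to `G`. -/
def IsTorsion (M : Type u) [AddCommGroup M] [Module R M] : Prop :=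
  ∀ x : M, Ideal.torsionOf R M x ∈ G.sets

/-- A module `M` is `G`-torsion-free if no nonzero element is annihilated by an ideal of `G`. -/
def IsTorsionFree (M : Type u) [AddCommGroup M] [Module R M] : Prop :=
  ∀ x : M, Ideal.torsionOf R M x ∈ G.sets → x = 0

/-- A module `M` is `G`-divisible if `JM = M` for every `J ∈ G`. -/
def IsDivisible (M : Type u) [AddCommGroup M] [Module R M] : Prop :=
  ∀ J ∈ G.sets, J • (⊤ : Submodule R M) = ⊤

/-- `G` is faithful if `R` is `G`-torsion-free. -/
def Faithful : Prop := ∀ r : R, Ideal.torsionOf R R r ∈ G.sets → r = 0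

/-- `G` is finitely generated if it has a basis of finitely generated ideals. -/
def FinitelyGenerated : Prop := ∀ J ∈ G.sets, ∃ J' ∈ G.sets, J' ≤ J ∧ J'.FG

end GabrielTopology

/-- `Ext¹_R(M, N) = 0`, expressed by the standard characterisation:
every short exact sequence `0 → N → E → M → 0` splits. -/
def Ext1Vanish (R : Type u) [CommRing R] (M N : Type u) [AddCommGroup M] [Module R M]
    [AddCommGroup N] [Module R N] : Prop :=
  ∀ (E : Type u) [AddCommGroup E] [Module R E] (i : N →ₗ[R] E) (p : E →ₗ[R] M),
    Function.Injective i → Function.Surjective p → LinearMap.range i = LinearMap.ker p →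
      ∃ s : M →ₗ[R] E, p ∘ₗ s = LinearMap.id

/-- `M` has projective dimension at most 1: the kernel of a free cover is projective. -/
def ProjDimLE1 (R : Type u) [CommRing R] (M : Type u) [AddCommGroup M] [Module R M] : Prop :=
  ∃ (ι : Type u) (p : (ι →₀ R) →ₗ[R] M),
    Function.Surjective p ∧ Module.Projective R ↥(LinearMap.ker p)

/-- `M ∈ Add(T)`: `M` is a direct summand of a direct sum of copies of `T`. -/
def InAdd (R : Type u) [CommRing R] (T M : Type u) [AddCommGroup T] [Module R T]
    [AddCommGroup M] [Module R M] : Prop :=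
  ∃ (ι : Type u) (s : M →ₗ[R] (ι →₀ T)) (r : (ι →₀ T) →ₗ[R] M), r ∘ₗ s = LinearMap.id

/-- `T` is a 1-tilting module: (T1) `p.dim T ≤ 1`, (T2) `Ext¹(T, T^(κ)) = 0` for all κ,
(T3) there is an exact sequence `0 → R → T₀ → T₁ → 0` with `T₀, T₁ ∈ Add(T)`. -/
def Is1Tilting (R : Type u) [CommRing R] (T : Type u) [AddCommGroup T] [Module R T] : Prop :=
  ProjDimLE1 R T ∧
  (∀ ι : Type u, Ext1Vanish R T (ι →₀ T)) ∧
  ∃ (T0 T1 : ModuleCat.{u} R) (i : R →ₗ[R] ↥T0) (p : ↥T0 →ₗ[R] ↥T1),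
    InAdd R T ↥T0 ∧ InAdd R T ↥T1 ∧
    Function.Injective i ∧ Function.Surjective p ∧ LinearMap.range i = LinearMap.ker p

namespace GabrielTopology

variable {R : Type u} [CommRing R] (G : GabrielTopology R)

/-- `(𝒜, 𝒟_G)` is a 1-tilting cotorsion pair with associated Gabriel topology `G`:
`G` is a faithful finitely generated Gabriel topology and the class of `G`-divisible
modules is the tilting class of a 1-tilting module. -/
def IsTiltingTopology : Prop :=
  G.Faithful ∧ G.FinitelyGenerated ∧
  ∃ T : ModuleCat.{u} R, Is1Tilting R ↥T ∧
    ∀ (M : Type u) [AddCommGroup M] [Module R M], (Ext1Vanish R ↥T M ↔ G.IsDivisible M)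

/-- Membership in the left-hand class `𝒜 = ᗮ(𝒟_G)` of the 1-tilting cotorsion pair. -/
def MemA (M : Type u) [AddCommGroup M] [Module R M] : Prop :=
  ∀ (D : Type u) [AddCommGroup D] [Module R D], G.IsDivisible D → Ext1Vanish R M D

/-- The class `𝒜` is covering: every module has an `𝒜`-cover. -/
def IsACovering : Prop :=
  ∀ (M : Type u) [AddCommGroup M] [Module R M],
    ∃ (C : ModuleCat.{u} R) (φ : ↥C →ₗ[R] M),
      G.MemA ↥C ∧
      (∀ (C' : Type u) [AddCommGroup C'] [Module R C'], G.MemA C' →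
        ∀ f : C' →ₗ[R] M, ∃ g : C' →ₗ[R] ↥C, φ ∘ₗ g = f) ∧
      (∀ e : ↥C →ₗ[R] ↥C, φ ∘ₗ e = φ → Function.Bijective e)

/-- The class `𝒜` is closed under direct limits. -/
def AClosedUnderDirectLimits : Prop :=
  ∀ (ι : Type u) [Preorder ι] [IsDirected ι (· ≤ ·)] [Nonempty ι] [DecidableEq ι]
    (M : ι → Type u) [∀ i, AddCommGroup (M i)] [∀ i, Module R (M i)]
    (f : ∀ i j, i ≤ j → M i →ₗ[R] M j) [DirectedSystem M fun i j h => f i j h],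
    (∀ i, G.MemA (M i)) → G.MemA (Module.DirectLimit M f)

/-- `Q`, via `algebraMap R Q`, is the ring of quotients `R_G` of `R` with respect to `G`:
`Q` is `G`-torsion-free and `G`-injective (i.e. `G`-closed) and the kernel and cokernel
of `R → Q` are `G`-torsion. -/
structure IsRingOfQuotients (Q : Type u) [CommRing Q] [Algebra R Q] : Prop where
  torsionFree : ∀ q : Q, Ideal.torsionOf R Q q ∈ G.sets → q = 0
  gInjective : ∀ J ∈ G.sets, ∀ f : ↥J →ₗ[R] Q, ∃ q : Q, ∀ j : ↥J, f j = (j : R) • q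
  ker_torsion : ∀ r : R, algebraMap R Q r = 0 → Ideal.torsionOf R R r ∈ G.sets
  coker_torsion : ∀ q : Q, ∃ J ∈ G.sets, ∀ x ∈ J, ∃ r : R, x • q = algebraMap R Q r

/-- `G` is a perfect Gabriel topology, realised by the perfect localisation `Q`:
`R → Q` is a flat ring epimorphism and `G = {J ∣ JQ = Q}`. -/
def IsPerfectLocalization (Q : Type u) [CommRing Q] [Algebra R Q] : Prop :=
  Module.Flat R Q ∧
  (∀ (S : Type u) [CommRing S] (f g : Q →+* S),
    f.comp (algebraMap R Q) = g.comp (algebraMap R Q) → f = g) ∧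
  (∀ J : Ideal R, J ∈ G.sets ↔ J • (⊤ : Submodule R Q) = ⊤)

end GabrielTopology

/-- A commutative ring is perfect iff every flat module is projective. -/
def IsPerfectRing (S : Type u) [CommRing S] : Prop :=
  ∀ (M : Type u) [AddCommGroup M] [Module S M], Module.Flat S M → Module.Projective S M

/-- `X` is Σ-pure-split: every pure embedding `A ⊆ B` with `B ∈ Add(X)` splits. -/
def SigmaPureSplit (R : Type u) [CommRing R] (X : Type u) [AddCommGroup X] [Module R X] : Prop :=
  ∀ (A B : Type u) [AddCommGroup A] [Module R A] [AddCommGroup B] [Module R B] (i : A →ₗ[R] B),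
    Function.Injective i →
    (∀ (M : Type u) [AddCommGroup M] [Module R M], Function.Injective (LinearMap.rTensor M i)) →
    InAdd R X B → ∃ r : B →ₗ[R] A, r ∘ₗ i = LinearMap.id

/-- A concrete model of `Ext¹_R(M, N)`, computed from the canonical free presentation
`0 → S → (M →₀ R) → M → 0` of `M` as `coker (Hom((M →₀ R), N) → Hom(S, N))`. -/
abbrev ext1 (R : Type u) [CommRing R] (M N : Type u) [AddCommGroup M] [Module R M]
    [AddCommGroup N] [Module R N] : Type u :=
  (↥(LinearMap.ker (Finsupp.linearCombination R (id : M → M))) →ₗ[R] N) ⧸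
    LinearMap.range
      (LinearMap.lcomp R N (LinearMap.ker (Finsupp.linearCombination R (id : M → M))).subtype)

/-- A concrete model of `Tor₁^R(M, N)`, computed from the canonical free presentation
`0 → S → (M →₀ R) → M → 0` of `M` as `ker (S ⊗ N → (M →₀ R) ⊗ N)`. -/
abbrev tor1 (R : Type u) [CommRing R] (M N : Type u) [AddCommGroup M] [Module R M]
    [AddCommGroup N] [Module R N] : Type u :=
  ↥(LinearMap.ker
    (LinearMap.rTensor N (LinearMap.ker (Finsupp.linearCombination R (id : M → M))).subtype))

/-- The cokernel `U/R` of a ring map `R → U`. -/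
abbrev cokerAlg (R U : Type u) [CommRing R] [CommRing U] [Algebra R U] : Type u :=
  U ⧸ LinearMap.range (Algebra.linearMap R U)

/-- A linear topology on a commutative ring `R`, given by its filter of open ideals. -/
structure LinearTopologyOn (R : Type u) [CommRing R] : Type u where
  sets : Set (Ideal R)
  top_mem : (⊤ : Ideal R) ∈ sets
  mem_of_le : ∀ {I J : Ideal R}, I ∈ sets → I ≤ J → J ∈ sets
  inf_mem : ∀ {I J : Ideal R}, I ∈ sets → J ∈ sets → I ⊓ J ∈ sets

/-- An `R`-module `M` is `H`-discrete if the annihilator of every element is open. -/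
def LinearTopologyOn.IsDiscrete {R : Type u} [CommRing R] (H : LinearTopologyOn R)
    (M : Type u) [AddCommGroup M] [Module R M] : Prop :=
  ∀ x : M, Ideal.torsionOf R M x ∈ H.sets

/-- `R` is `H`-h-local: every open ideal is contained in only finitely many maximal ideals,
and every open prime ideal is contained in only one maximal ideal. -/
def LinearTopologyOn.IsHLocal {R : Type u} [CommRing R] (H : LinearTopologyOn R) : Prop :=
  (∀ J ∈ H.sets, {m : Ideal R | m.IsMaximal ∧ J ≤ m}.Finite) ∧
  (∀ p ∈ H.sets, p.IsPrime →
    ∀ m n : Ideal R, m.IsMaximal → n.IsMaximal → p ≤ m → p ≤ n → m = n)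

/-- Over `S`, `M` admits a resolution of length `n` by finitely generated projectives. -/
def FGProjDimLE (S : Type u) [CommRing S] :
    ℕ → ∀ (M : Type u) [AddCommGroup M] [Module S M], Prop
  | 0, M, iA, iM =>
      letI := iA; letI := iM
      Module.Finite S M ∧ Module.Projective S M
  | n + 1, M, iA, iM =>
      letI := iA; letI := iM
      ∃ (k : ℕ) (f : (Fin k → S) →ₗ[S] M),
        Function.Surjective f ∧ FGProjDimLE S n ↥(LinearMap.ker f)

section Factoring

variable {R : Type*} [CommRing R] {X Y Z : Type*} [AddCommGroup X] [Module R X]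
  [AddCommGroup Y] [Module R Y] [AddCommGroup Z] [Module R Z]

lemma LinearMap.exists_comp_eq_of_surjective (p : X →ₗ[R] Y) (hp : Function.Surjective p)
    (g : X →ₗ[R] Z) (h : ∀ x, p x = 0 → g x = 0) : ∃ k : Y →ₗ[R] Z, ∀ x, k (p x) = g x := by
  refine ⟨(LinearMap.ker p).liftQ g (fun x hx => h x hx) ∘ₗ
    (p.quotKerEquivOfSurjective hp).symm, fun x => ?_⟩
  have : (p.quotKerEquivOfSurjective hp).symm (p x) = Submodule.Quotient.mk x := by
    rw [LinearEquiv.symm_apply_eq]; rfl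
  rw [LinearMap.comp_apply, LinearEquiv.coe_coe, this]
  exact Submodule.liftQ_apply _ _ _

lemma LinearMap.exists_comp_eq_of_injective (i : Y →ₗ[R] X) (hi : Function.Injective i)
    (g : Z →ₗ[R] X) (h : ∀ z, ∃ y, i y = g z) : ∃ k : Z →ₗ[R] Y, ∀ z, i (k z) = g z := by
  refine ⟨(LinearEquiv.ofInjective i hi).symm ∘ₗ
    g.codRestrict (LinearMap.range i) (fun z => h z), fun z => ?_⟩
  exact congrArg Subtype.val ((LinearEquiv.ofInjective i hi).apply_symm_apply
    (g.codRestrict (LinearMap.range i) (fun z => h z) z))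

end Factoring

namespace Ext1Vanish

variable {R : Type u} [CommRing R] {L D X Y E M N : Type u} [AddCommGroup L] [Module R L]
  [AddCommGroup D] [Module R D] [AddCommGroup X] [Module R X] [AddCommGroup Y] [Module R Y]
  [AddCommGroup E] [Module R E] [AddCommGroup M] [Module R M] [AddCommGroup N] [Module R N]

/-- Maps out of the kernel of an epimorphism onto `L` extend. -/
lemma extend (h : Ext1Vanish R L D) (i : Y →ₗ[R] X) (p : X →ₗ[R] L)
    (hi : Function.Injective i) (hp : Function.Surjective p) (hip : Function.Exact i p)
    (f : Y →ₗ[R] D) : ∃ g : X →ₗ[R] D, ∀ y, g (i y) = f y := by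
  let W : Submodule R (D × X) := LinearMap.range (f.prod (-i))
  let j : D →ₗ[R] (D × X) ⧸ W := W.mkQ ∘ₗ LinearMap.inl R D X
  have hq : W ≤ LinearMap.ker (p ∘ₗ LinearMap.snd R D X) := by
    rintro _ ⟨y, rfl⟩
    simp [hip.apply_apply_eq_zero]
  let q : (D × X) ⧸ W →ₗ[R] L := W.liftQ _ hq
  have hj : Function.Injective j := by
    rw [injective_iff_map_eq_zero]
    intro d hd
    have : ((d, 0) : D × X) ∈ W := by simpa [j] using hd
    obtain ⟨y, hy⟩ := this
    have hy1 : f y = d := congrArg Prod.fst hy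
    have hy2 : -i y = 0 := congrArg Prod.snd hy
    have : y = 0 := hi (by simpa using hy2)
    rw [← hy1, this, map_zero]
  have hqs : Function.Surjective q := by
    intro l
    obtain ⟨x, rfl⟩ := hp l
    exact ⟨W.mkQ (0, x), by simp [q]⟩
  have hjq : LinearMap.range j = LinearMap.ker q := by
    apply le_antisymm
    · rintro _ ⟨d, rfl⟩
      simp [j, q]
    · intro e he
      obtain ⟨⟨d, x⟩, rfl⟩ := W.mkQ_surjective e
      have hx : p x = 0 := by simpa [q] using he
      obtain ⟨y, rfl⟩ := (hip x).1 hx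
      refine ⟨d + f y, ?_⟩
      simp only [j, LinearMap.comp_apply, LinearMap.inl_apply]
      rw [← sub_eq_zero, ← map_sub]
      refine (Submodule.Quotient.mk_eq_zero W).2 ⟨y, by simp⟩
  obtain ⟨s, hs⟩ := h _ j q hj hqs hjq
  obtain ⟨k, hk⟩ := LinearMap.exists_comp_eq_of_injective j hj
    (W.mkQ ∘ₗ LinearMap.inr R D X - s ∘ₗ p) (fun x => by
      have : (W.mkQ ∘ₗ LinearMap.inr R D X - s ∘ₗ p) x ∈ LinearMap.range j := by
        rw [hjq, LinearMap.mem_ker, LinearMap.sub_apply, map_sub]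
        have := LinearMap.congr_fun hs (p x)
        simp only [LinearMap.comp_apply, LinearMap.id_apply] at this ⊢
        rw [this]; simp [q]
      exact this)
  refine ⟨k, fun y => hj ?_⟩
  rw [hk, LinearMap.sub_apply, LinearMap.comp_apply, LinearMap.comp_apply,
    hip.apply_apply_eq_zero, map_zero, sub_zero, eq_comm, ← sub_eq_zero]
  simp only [j, LinearMap.comp_apply]
  rw [← map_sub]
  exact (Submodule.Quotient.mk_eq_zero W).2 ⟨y, by simp⟩

/-- Maps lift along morphisms whose image contains the image of the map. -/
lemma lift (h : Ext1Vanish R X N) (i : N →ₗ[R] E) (p : E →ₗ[R] M)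
    (hi : Function.Injective i) (hip : Function.Exact i p) (f : X →ₗ[R] M)
    (hf : ∀ x, ∃ e, p e = f x) : ∃ g : X →ₗ[R] E, ∀ x, p (g x) = f x := by
  let P : Submodule R (E × X) :=
    LinearMap.ker (p ∘ₗ LinearMap.fst R E X - f ∘ₗ LinearMap.snd R E X)
  have hP : ∀ e : P, p e.1.1 = f e.1.2 := fun e => sub_eq_zero.1 e.2
  let j : N →ₗ[R] P := (LinearMap.inl R E X ∘ₗ i).codRestrict P (fun n => by
    simp [P, hip.apply_apply_eq_zero])
  let q : P →ₗ[R] X := LinearMap.snd R E X ∘ₗ P.subtype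
  have ⟨s, hs⟩ := h P j q ?_ ?_ ?_
  · refine ⟨LinearMap.fst R E X ∘ₗ P.subtype ∘ₗ s, fun x => ?_⟩
    have := hP (s x)
    have h2 := LinearMap.congr_fun hs x
    simp only [q, LinearMap.comp_apply, LinearMap.snd_apply, Submodule.subtype_apply,
      LinearMap.id_apply] at h2
    rw [h2] at this
    exact this
  · exact fun a b hab => hi (congrArg (fun z : P => z.1.1) hab)
  · intro x
    obtain ⟨e, he⟩ := hf x
    exact ⟨⟨(e, x), by simp [P, he]⟩, rfl⟩
  · apply le_antisymm
    · rintro _ ⟨n, rfl⟩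
      exact (rfl : (j n).1.2 = 0)
    · intro z hz
      have hz2 : z.1.2 = 0 := hz
      have := hP z
      rw [hz2, map_zero] at this
      obtain ⟨n, hn⟩ := (hip _).1 this
      refine ⟨n, Subtype.ext (Prod.ext hn hz2.symm)⟩

lemma lift_ker (p : E →ₗ[R] M) (h : Ext1Vanish R X (LinearMap.ker p)) (f : X →ₗ[R] M)
    (hf : ∀ x, ∃ e, p e = f x) : ∃ g : X →ₗ[R] E, ∀ x, p (g x) = f x :=
  h.lift _ p (Submodule.subtype_injective _) p.exact_subtype_ker_map f hf

lemma of_lift (h : ∀ (E : Type u) [AddCommGroup E] [Module R E] (i : N →ₗ[R] E) (p : E →ₗ[R] M),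
    Function.Injective i → Function.Surjective p → Function.Exact i p →
      ∃ s : M →ₗ[R] E, ∀ x, p (s x) = x) : Ext1Vanish R M N := by
  intro E _ _ i p hi hp hip
  obtain ⟨s, hs⟩ := h E i p hi hp (LinearMap.exact_iff.2 hip.symm)
  exact ⟨s, LinearMap.ext hs⟩

lemma of_projective [Module.Projective R M] : Ext1Vanish R M N :=
  of_lift fun E _ _ i p _ hp _ => by
    obtain ⟨s, hs⟩ := Module.projective_lifting_property p LinearMap.id hp
    exact ⟨s, fun x => LinearMap.congr_fun hs x⟩

lemma of_extend (hX : Ext1Vanish R X D) (i : Y →ₗ[R] X) (p : X →ₗ[R] L)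
    (hp : Function.Surjective p) (hip : Function.Exact i p)
    (hext : ∀ f : Y →ₗ[R] D, ∃ g : X →ₗ[R] D, ∀ y, g (i y) = f y) : Ext1Vanish R L D :=
  of_lift fun E _ _ j q hj hq hjq => by
    obtain ⟨s, hs⟩ := hX.lift j q hj hjq p (fun x => hq _)
    obtain ⟨f, hf⟩ := LinearMap.exists_comp_eq_of_injective j hj (s ∘ₗ i) (fun y =>
      (hjq _).1 (by simp [hs, hip.apply_apply_eq_zero]))
    obtain ⟨g, hg⟩ := hext f
    obtain ⟨k, hk⟩ := LinearMap.exists_comp_eq_of_surjective p hp (s - j ∘ₗ g) (fun x hx => by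
      obtain ⟨y, rfl⟩ := (hip x).1 hx
      simp [hg, hf])
    refine ⟨k, fun l => ?_⟩
    obtain ⟨x, rfl⟩ := hp l
    simp [hk, hs, hjq.apply_apply_eq_zero]

lemma of_retract (h : Ext1Vanish R X D) (s : L →ₗ[R] X) (r : X →ₗ[R] L)
    (hrs : ∀ l, r (s l) = l) : Ext1Vanish R L D :=
  of_lift fun E _ _ j q hj hq hjq => by
    obtain ⟨g, hg⟩ := h.lift j q hj hjq r (fun x => hq _)
    exact ⟨g ∘ₗ s, fun l => by simp [hg, hrs]⟩

lemma of_linearEquiv (h : Ext1Vanish R X D) (e : X ≃ₗ[R] L) : Ext1Vanish R L D :=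
  h.of_retract e.symm.toLinearMap e.toLinearMap (by simp)

lemma of_injective [hD : Module.Injective R D] : Ext1Vanish R M D :=
  of_lift fun E _ _ j q hj hq hjq => by
    obtain ⟨g, hg⟩ := hD.out j hj LinearMap.id
    obtain ⟨k, hk⟩ := LinearMap.exists_comp_eq_of_surjective q hq (LinearMap.id - j ∘ₗ g)
      (fun x hx => by
        obtain ⟨y, rfl⟩ := (hjq x).1 hx
        simp [hg])
    refine ⟨k, fun l => ?_⟩
    obtain ⟨x, rfl⟩ := hq l
    simp [hk, hjq.apply_apply_eq_zero]

lemma extension (i : L →ₗ[R] M) (p : M →ₗ[R] N) (hp : Function.Surjective p)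
    (hip : Function.Exact i p) (hi : Function.Injective i)
    (hL : Ext1Vanish R L D) (hN : Ext1Vanish R N D) : Ext1Vanish R M D :=
  of_lift fun E _ _ j q hj hq hjq => by
    obtain ⟨s, hs⟩ := hL.lift j q hj hjq i (fun x => hq _)
    have hex : Function.Exact (j.coprod s) (p ∘ₗ q) := by
      intro e
      constructor
      · intro he
        obtain ⟨l, hl⟩ := (hip _).1 he
        have : q (e - s l) = 0 := by simp [hs, hl]
        obtain ⟨d, hd⟩ := (hjq _).1 this
        exact ⟨(d, l), by simp [hd]⟩
      · rintro ⟨⟨d, l⟩, rfl⟩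
        simp [hjq.apply_apply_eq_zero, hs, hip.apply_apply_eq_zero]
    have hinj : Function.Injective (j.coprod s) := by
      rw [injective_iff_map_eq_zero]
      rintro ⟨d, l⟩ h
      simp only [LinearMap.coprod_apply] at h
      have h2 := congrArg q h
      simp only [map_add, hjq.apply_apply_eq_zero, hs, zero_add, map_zero] at h2
      have hl : l = 0 := hi (by simpa using h2)
      subst hl
      have hd : d = 0 := hj (by simpa using h)
      rw [hd]; rfl
    obtain ⟨g, hg⟩ := hN.extend (j.coprod s) (p ∘ₗ q) hinj (hp.comp hq) hex
      (LinearMap.fst R D L)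
    obtain ⟨k, hk⟩ := LinearMap.exists_comp_eq_of_surjective q hq (LinearMap.id - j ∘ₗ g)
      (fun x hx => by
        obtain ⟨d, rfl⟩ := (hjq x).1 hx
        have := hg (d, 0)
        simp only [LinearMap.coprod_apply, map_zero, add_zero, LinearMap.fst_apply] at this
        simp [this])
    refine ⟨k, fun l => ?_⟩
    obtain ⟨x, rfl⟩ := hq l
    simp [hk, hjq.apply_apply_eq_zero]

open DirectSum in
lemma directSum {ι : Type u} (A : ι → Type u) [∀ i, AddCommGroup (A i)] [∀ i, Module R (A i)]
    (h : ∀ i, Ext1Vanish R (A i) D) : Ext1Vanish R (⨁ i, A i) D :=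
  of_lift fun E _ _ j q hj hq hjq => by
    classical
    have := fun i => (h i).lift j q hj hjq (DirectSum.lof R ι A i) (fun x => hq _)
    choose g hg using this
    refine ⟨DirectSum.toModule R ι E g, fun x => ?_⟩
    have : q ∘ₗ DirectSum.toModule R ι E g = LinearMap.id := by
      ext i x : 2
      simp [hg]
    exact LinearMap.congr_fun this x

lemma finsupp {ι : Type u} (h : Ext1Vanish R L D) : Ext1Vanish R (ι →₀ L) D := by
  classical
  exact (directSum (fun _ : ι => L) fun _ => h).of_linearEquiv
    (finsuppLEquivDirectSum R L ι).symm

end Ext1Vanish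

lemma Module.exists_injective_embedding (R : Type u) [CommRing R] (M : Type u) [AddCommGroup M]
    [Module R M] : ∃ (I : ModuleCat.{u} R) (i : M →ₗ[R] I), Function.Injective i ∧
      Module.Injective R I := by
  let J := CategoryTheory.Injective.under (ModuleCat.of R M)
  refine ⟨J, (CategoryTheory.Injective.ι (ModuleCat.of R M)).hom, ?_, ?_⟩
  · exact (ModuleCat.mono_iff_injective _).1 inferInstance
  · have : CategoryTheory.Injective (ModuleCat.of R J) :=
      inferInstanceAs (CategoryTheory.Injective J)
    exact Module.injective_module_of_injective_object R J

namespace GabrielTopology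

variable {R : Type u} [CommRing R] {G : GabrielTopology R}

section Divisible

variable {M N : Type u} [AddCommGroup M] [Module R M] [AddCommGroup N] [Module R N]

lemma IsDivisible.range_le (h : G.IsDivisible M) (f : M →ₗ[R] N) {J : Ideal R}
    (hJ : J ∈ G.sets) : LinearMap.range f ≤ J • (⊤ : Submodule R N) := by
  rw [LinearMap.range_eq_map, ← h J hJ, Submodule.map_smul'']
  exact Submodule.smul_mono le_rfl le_top

lemma IsDivisible.of_iSup {ι : Type*} {A : ι → Type u} [∀ i, AddCommGroup (A i)]
    [∀ i, Module R (A i)] (h : ∀ i, G.IsDivisible (A i)) (f : ∀ i, A i →ₗ[R] M)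
    (hf : ⨆ i, LinearMap.range (f i) = ⊤) : G.IsDivisible M := fun J hJ => by
  exact top_le_iff.1 (hf.symm.le.trans (iSup_le fun i => (h i).range_le (f i) hJ))

lemma IsDivisible.of_surjective (h : G.IsDivisible M) (f : M →ₗ[R] N)
    (hf : Function.Surjective f) : G.IsDivisible N :=
  .of_iSup (fun _ : Unit => h) (fun _ => f) (by simp [LinearMap.range_eq_top.2 hf])

lemma IsDivisible.quotient (h : G.IsDivisible M) (K : Submodule R M) : G.IsDivisible (M ⧸ K) :=
  h.of_surjective K.mkQ K.mkQ_surjective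

end Divisible

namespace MemA

variable {L X M N : Type u} [AddCommGroup L] [Module R L] [AddCommGroup X] [Module R X]
  [AddCommGroup M] [Module R M] [AddCommGroup N] [Module R N]

lemma of_projective [Module.Projective R M] : G.MemA M := fun _ _ _ _ => .of_projective

lemma of_retract (h : G.MemA X) (s : L →ₗ[R] X) (r : X →ₗ[R] L) (hrs : ∀ l, r (s l) = l) :
    G.MemA L := fun D _ _ hD => (h D hD).of_retract s r hrs

lemma of_linearEquiv (h : G.MemA X) (e : X ≃ₗ[R] L) : G.MemA L :=
  fun D _ _ hD => (h D hD).of_linearEquiv e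

open DirectSum in
lemma directSum {ι : Type u} {A : ι → Type u} [∀ i, AddCommGroup (A i)] [∀ i, Module R (A i)]
    (h : ∀ i, G.MemA (A i)) : G.MemA (⨁ i, A i) :=
  fun D _ _ hD => .directSum A fun i => h i D hD

lemma finsupp {ι : Type u} (h : G.MemA L) : G.MemA (ι →₀ L) := fun D _ _ hD => (h D hD).finsupp

lemma extension (i : L →ₗ[R] M) (p : M →ₗ[R] N) (hp : Function.Surjective p)
    (hip : Function.Exact i p) (hi : Function.Injective i) (hL : G.MemA L) (hN : G.MemA N) :
    G.MemA M := fun D _ _ hD => .extension i p hp hip hi (hL D hD) (hN D hD)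

lemma of_subsingleton [Subsingleton M] : G.MemA M :=
  of_retract (X := R) of_projective 0 0 fun _ => Subsingleton.elim _ _

end MemA

lemma IsTiltingTopology.isDivisible_of_injective (hG : G.IsTiltingTopology) (I : Type u)
    [AddCommGroup I] [Module R I] [Module.Injective R I] : G.IsDivisible I := by
  obtain ⟨_, _, T, _, h⟩ := hG
  exact (h I).1 .of_injective

/-- Modules in the left-hand class have projective dimension at most one. -/
lemma MemA.projective_of_exact (hG : G.IsTiltingTopology) {A F N : Type u} [AddCommGroup A]
    [Module R A] [AddCommGroup F] [Module R F] [AddCommGroup N] [Module R N] (hA : G.MemA A)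
    [Module.Projective R F] (i : N →ₗ[R] F) (p : F →ₗ[R] A) (hi : Function.Injective i)
    (hp : Function.Surjective p) (hip : Function.Exact i p) : Module.Projective R N := by
  refine Module.Projective.of_lifting_property'' fun q hq => ?_
  obtain ⟨I, e, he, hI⟩ := Module.exists_injective_embedding R (N →₀ R)
  let K : Submodule R I := (LinearMap.ker q).map e
  obtain ⟨a, ha⟩ := LinearMap.exists_comp_eq_of_surjective q hq (K.mkQ ∘ₗ e) (fun x hx => by
    rw [LinearMap.comp_apply]
    exact (Submodule.Quotient.mk_eq_zero K).2 ⟨x, hx, rfl⟩)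
  obtain ⟨b, hb⟩ := (hA _ ((hG.isDivisible_of_injective I).quotient K)).extend i p hi hp hip a
  obtain ⟨c, hc⟩ := Module.projective_lifting_property K.mkQ b K.mkQ_surjective
  have key : ∀ n, ∃ y, e y = c (i n) ∧ q y = n := by
    intro n
    obtain ⟨y, rfl⟩ := hq n
    have h1 : K.mkQ (c (i (q y))) = K.mkQ (e y) := by
      have := LinearMap.congr_fun hc (i (q y))
      rw [LinearMap.comp_apply] at this
      rw [this, hb, ha]; rfl
    have h2 : c (i (q y)) - e y ∈ K := (Submodule.Quotient.eq K).1 h1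
    obtain ⟨k, hk, hk2⟩ := h2
    exact ⟨y + k, by simp [hk2], by rw [map_add, LinearMap.mem_ker.1 hk, add_zero]⟩
  obtain ⟨s, hs⟩ := LinearMap.exists_comp_eq_of_injective e he (c ∘ₗ i) (fun n => by
    obtain ⟨y, hy, _⟩ := key n
    exact ⟨y, hy⟩)
  refine ⟨s, LinearMap.ext fun n => ?_⟩
  obtain ⟨y, hy, hy2⟩ := key n
  have : s n = y := he (by rw [hs, hy]; rfl)
  simp [this, hy2]

lemma MemA.projDimLE1 (hG : G.IsTiltingTopology) {A : Type u} [AddCommGroup A] [Module R A]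
    (hA : G.MemA A) : ProjDimLE1 R A :=
  ⟨A, Finsupp.linearCombination R id, Finsupp.linearCombination_id_surjective R A,
    hA.projective_of_exact hG _ _ (Submodule.subtype_injective _)
      (Finsupp.linearCombination_id_surjective R A) (LinearMap.exact_subtype_ker_map _)⟩

/-- The left-hand class is closed under kernels of epimorphisms. -/
lemma MemA.of_exact (hG : G.IsTiltingTopology) {A B C : Type u} [AddCommGroup A] [Module R A]
    [AddCommGroup B] [Module R B] [AddCommGroup C] [Module R C] (i : A →ₗ[R] B) (p : B →ₗ[R] C)
    (hi : Function.Injective i) (hp : Function.Surjective p) (hip : Function.Exact i p)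
    (hB : G.MemA B) (hC : G.MemA C) : G.MemA A := by
  obtain ⟨F, _, _, hF, π, hπ⟩ : ∃ (F : Type u) (_ : AddCommGroup F) (_ : Module R F)
      (_ : Module.Projective R F) (π : F →ₗ[R] B), Function.Surjective π :=
    ⟨B →₀ R, inferInstance, inferInstance, inferInstance, _,
      Finsupp.linearCombination_id_surjective R B⟩
  obtain ⟨N, _, _, j, hj, hjp⟩ : ∃ (N : Type u) (_ : AddCommGroup N) (_ : Module R N)
      (j : N →ₗ[R] F), Function.Injective j ∧ Function.Exact j (p ∘ₗ π) :=
    ⟨LinearMap.ker (p ∘ₗ π), inferInstance, inferInstance, _, Submodule.subtype_injective _,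
      LinearMap.exact_subtype_ker_map _⟩
  obtain ⟨K, _, _, k, hk, hkp⟩ : ∃ (K : Type u) (_ : AddCommGroup K) (_ : Module R K)
      (k : K →ₗ[R] F), Function.Injective k ∧ Function.Exact k π :=
    ⟨LinearMap.ker π, inferInstance, inferInstance, _, Submodule.subtype_injective _,
      LinearMap.exact_subtype_ker_map _⟩
  have hN : Module.Projective R N := hC.projective_of_exact hG j (p ∘ₗ π) hj (hp.comp hπ) hjp
  obtain ⟨q, hq⟩ := LinearMap.exists_comp_eq_of_injective i hi (π ∘ₗ j)
    (fun n => (hip _).1 (hjp.apply_apply_eq_zero n))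
  obtain ⟨l, hl⟩ := LinearMap.exists_comp_eq_of_injective j hj k
    (fun x => (hjp _).1 (by simp [hkp.apply_apply_eq_zero]))
  intro D _ _ hD
  refine Ext1Vanish.of_extend .of_projective l q ?_ ?_ ?_
  · intro a
    obtain ⟨y, hy⟩ := hπ (i a)
    obtain ⟨n, rfl⟩ := (hjp y).1 (by simp [hy, hip.apply_apply_eq_zero])
    exact ⟨n, hi (by rw [hq]; exact hy)⟩
  · intro n
    rw [← map_eq_zero_iff i hi, hq, LinearMap.comp_apply, hkp]
    constructor
    · rintro ⟨x, hx⟩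
      exact ⟨x, hj (by rw [hl, hx])⟩
    · rintro ⟨x, rfl⟩
      exact ⟨x, (hl x).symm⟩
  · intro f
    obtain ⟨g, hg⟩ := (hB D hD).extend k π hk hπ hkp f
    exact ⟨g ∘ₗ j, fun y => by simp [hl, hg]⟩

lemma IsTiltingTopology.exists_tilting (hG : G.IsTiltingTopology) : ∃ T : ModuleCat.{u} R,
    Is1Tilting R T ∧ G.MemA T ∧ G.IsDivisible T ∧
      ∀ (M : Type u) [AddCommGroup M] [Module R M], (Ext1Vanish R ↥T M ↔ G.IsDivisible M) := by
  obtain ⟨_, _, T, hT, h⟩ := hG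
  refine ⟨T, hT, fun D _ _ hD => (h D).2 hD, ?_, h⟩
  have := ((h _).1 (hT.2.1 PUnit))
  exact this.of_surjective (Finsupp.lapply PUnit.unit)
    (fun t => ⟨Finsupp.single PUnit.unit t, by simp⟩)

end GabrielTopology

section Pushout

variable {R : Type u} [CommRing R] {K E F M C : Type u} [AddCommGroup K] [Module R K]
  [AddCommGroup E] [Module R E] [AddCommGroup F] [Module R F] [AddCommGroup M] [Module R M]
  [AddCommGroup C] [Module R C]

lemma LinearMap.exists_pushout (a : K →ₗ[R] E) (q : E →ₗ[R] C) (b : K →ₗ[R] F) (p : F →ₗ[R] M)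
    (ha : Function.Injective a) (hb : Function.Injective b) (hq : Function.Surjective q)
    (hp : Function.Surjective p) (haq : Function.Exact a q) (hbp : Function.Exact b p) :
    ∃ (X : ModuleCat.{u} R) (i : E →ₗ[R] X) (i' : F →ₗ[R] X) (π : X →ₗ[R] M) (π' : X →ₗ[R] C),
      Function.Injective i ∧ Function.Injective i' ∧ Function.Surjective π ∧
      Function.Surjective π' ∧ Function.Exact i π ∧ Function.Exact i' π' := by
  let W : Submodule R (E × F) := LinearMap.range (a.prod (-b))
  have hW : ∀ x y, (x, y) ∈ W ↔ ∃ k, a k = x ∧ -b k = y := fun x y => by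
    simp [W, Prod.ext_iff]
  have h1 : W ≤ LinearMap.ker (p ∘ₗ LinearMap.snd R E F) := by
    rintro _ ⟨y, rfl⟩
    simp [hbp.apply_apply_eq_zero]
  have h2 : W ≤ LinearMap.ker (q ∘ₗ LinearMap.fst R E F) := by
    rintro _ ⟨y, rfl⟩
    simp [haq.apply_apply_eq_zero]
  have hz : ∀ x, W.mkQ x = 0 ↔ x ∈ W := fun x => Submodule.Quotient.mk_eq_zero W
  refine ⟨ModuleCat.of R ((E × F) ⧸ W), W.mkQ ∘ₗ LinearMap.inl R E F,
    W.mkQ ∘ₗ LinearMap.inr R E F, W.liftQ _ h1, W.liftQ _ h2, ?_, ?_, ?_, ?_, ?_, ?_⟩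
  · rw [injective_iff_map_eq_zero]
    intro e he
    obtain ⟨k, rfl, hk⟩ := (hW _ _).1 ((hz _).1 he)
    rw [hb (show b k = b 0 by simpa using hk), map_zero]
  · rw [injective_iff_map_eq_zero]
    intro e he
    obtain ⟨k, hk, rfl⟩ := (hW _ _).1 ((hz _).1 he)
    rw [ha (show a k = a 0 by simpa using hk), map_zero, neg_zero]
  · intro m
    obtain ⟨f, rfl⟩ := hp m
    exact ⟨W.mkQ (0, f), by simp⟩
  · intro m
    obtain ⟨f, rfl⟩ := hq m
    exact ⟨W.mkQ (f, 0), by simp⟩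
  · intro x
    obtain ⟨⟨e, f⟩, rfl⟩ := W.mkQ_surjective x
    constructor
    · intro h
      obtain ⟨k, rfl⟩ := (hbp _).1 (by simpa using h)
      refine ⟨e + a k, ?_⟩
      rw [← sub_eq_zero, LinearMap.comp_apply, ← map_sub, hz]
      exact (hW _ _).2 ⟨k, by simp⟩
    · rintro ⟨e', he'⟩
      rw [← he']
      simp
  · intro x
    obtain ⟨⟨e, f⟩, rfl⟩ := W.mkQ_surjective x
    constructor
    · intro h
      obtain ⟨k, rfl⟩ := (haq _).1 (by simpa using h)
      refine ⟨f + b k, ?_⟩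
      rw [← sub_eq_zero, LinearMap.comp_apply, ← map_sub, hz]
      exact (hW _ _).2 ⟨-k, by simp⟩
    · rintro ⟨e', he'⟩
      rw [← he']
      simp

end Pushout

section Envelope

variable {R : Type u} [CommRing R] {P Q T : Type u} [AddCommGroup P] [Module R P]
  [AddCommGroup Q] [Module R Q] [AddCommGroup T] [Module R T] (i : P →ₗ[R] Q) (π : Q →ₗ[R] T)
  (L M N : Type u) [AddCommGroup L] [Module R L] [AddCommGroup M] [Module R M]
  [AddCommGroup N] [Module R N]

/-- The relations making every morphism `P → M` extend along `i : P → Q`. -/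
noncomputable def envelopeRel : Submodule R (M × ((P →ₗ[R] M) →₀ Q)) :=
  LinearMap.range ((Finsupp.lsum R (fun h : P →ₗ[R] M => h)).prod
    (-(Finsupp.mapRange.linearMap i)))

/-- The functorial one-step extension of `M` along which all morphisms `P → M` extend to `Q`. -/
abbrev Envelope : Type u := (M × ((P →ₗ[R] M) →₀ Q)) ⧸ envelopeRel i M

namespace Envelope

/-- The canonical map to the envelope. -/
noncomputable def unit : M →ₗ[R] Envelope i M := (envelopeRel i M).mkQ ∘ₗ LinearMap.inl R _ _

variable {L M N}

/-- Functoriality of the envelope. -/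
noncomputable def map (f : M →ₗ[R] N) : Envelope i M →ₗ[R] Envelope i N :=
  (envelopeRel i M).mapQ (envelopeRel i N)
    (f.prodMap (Finsupp.lmapDomain Q R (fun h : P →ₗ[R] M => f ∘ₗ h))) (by
      rintro _ ⟨z, rfl⟩
      refine ⟨Finsupp.mapDomain (fun h : P →ₗ[R] M => f ∘ₗ h) z, ?_⟩
      induction z using Finsupp.induction_linear with
      | zero => simp
      | add x y hx hy => rw [Finsupp.mapDomain_add, map_add, map_add, hx, hy, map_add]
      | single h x =>
        simp [Finsupp.mapDomain_single, ← Finsupp.single_neg])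

lemma map_mk (f : M →ₗ[R] N) (m : M) (w : (P →ₗ[R] M) →₀ Q) :
    map i f ((envelopeRel i M).mkQ (m, w)) =
      (envelopeRel i N).mkQ (f m, Finsupp.mapDomain (fun h : P →ₗ[R] M => f ∘ₗ h) w) := rfl

lemma map_unit (f : M →ₗ[R] N) (m : M) : map i f (unit i M m) = unit i N (f m) := by
  change map i f ((envelopeRel i M).mkQ (m, 0)) = (envelopeRel i N).mkQ (f m, 0)
  rw [map_mk, Finsupp.mapDomain_zero]

lemma map_id (x : Envelope i M) : map i LinearMap.id x = x := by
  obtain ⟨⟨m, w⟩, rfl⟩ := (envelopeRel i M).mkQ_surjective x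
  rw [map_mk]
  congr 2
  exact Finsupp.mapDomain_id

lemma map_comp (f : L →ₗ[R] M) (g : M →ₗ[R] N) (x : Envelope i L) :
    map i (g ∘ₗ f) x = map i g (map i f x) := by
  obtain ⟨⟨m, w⟩, rfl⟩ := (envelopeRel i L).mkQ_surjective x
  rw [map_mk, map_mk, map_mk, ← Finsupp.mapDomain_comp]
  rfl

variable {i π}

lemma mkQ_eq_zero_iff (m : M) (w : (P →ₗ[R] M) →₀ Q) :
    (envelopeRel i M).mkQ (m, w) = 0 ↔ ∃ z : (P →ₗ[R] M) →₀ P,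
      Finsupp.lsum R (fun h : P →ₗ[R] M => h) z = m ∧ -Finsupp.mapRange.linearMap i z = w := by
  rw [Submodule.mkQ_apply, Submodule.Quotient.mk_eq_zero, envelopeRel, LinearMap.mem_range]
  exact exists_congr fun z => Prod.ext_iff

lemma unit_injective (hi : Function.Injective i) : Function.Injective (unit i M) := by
  rw [injective_iff_map_eq_zero]
  intro m hm
  obtain ⟨z, rfl, hz⟩ := (mkQ_eq_zero_iff m 0).1 hm
  have : z = 0 := by
    refine Finsupp.mapRange_injective i (map_zero i) hi ?_
    rw [Finsupp.mapRange_zero]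
    simpa using hz
  rw [this, map_zero]

lemma exists_cokernel (hπ : Function.Surjective π) (hiπ : Function.Exact i π) :
    ∃ q : Envelope i M →ₗ[R] ((P →ₗ[R] M) →₀ T),
      Function.Surjective q ∧ Function.Exact (unit i M) q := by
  refine ⟨(envelopeRel i M).liftQ (Finsupp.mapRange.linearMap π ∘ₗ LinearMap.snd R _ _) ?_,
    ?_, ?_⟩
  · rintro _ ⟨z, rfl⟩
    ext h
    simp [hiπ.apply_apply_eq_zero]
  · intro t
    obtain ⟨w, hw⟩ := Finsupp.mapRange_surjective π (map_zero π) hπ t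
    exact ⟨(envelopeRel i M).mkQ (0, w), by simpa using hw⟩
  · intro x
    obtain ⟨⟨m, w⟩, rfl⟩ := (envelopeRel i M).mkQ_surjective x
    constructor
    · intro h
      have hw : ∀ a, π (w a) = 0 := fun a => by
        simpa using DFunLike.congr_fun h a
      have : ∃ z, Finsupp.mapRange.linearMap i z = w := by
        choose y hy using fun a => (hiπ _).1 (hw a)
        classical
        refine ⟨Finsupp.onFinset w.support (fun a => if w a = 0 then 0 else y a) (fun a ha => ?_),
          ?_⟩
        · simp only [ne_eq, ite_eq_left_iff, not_forall] at ha
          simpa using ha.1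
        · ext a
          by_cases h0 : w a = 0 <;> simp [h0, hy]
      obtain ⟨z, rfl⟩ := this
      refine ⟨m + Finsupp.lsum R (fun h : P →ₗ[R] M => h) z, ?_⟩
      change (envelopeRel i M).mkQ (_, 0) = _
      rw [← sub_eq_zero, ← map_sub, Prod.mk_sub_mk, mkQ_eq_zero_iff]
      exact ⟨z, by simp, by simp⟩
    · rintro ⟨m', hm'⟩
      rw [← hm']
      change (envelopeRel i M).liftQ _ _ ((envelopeRel i M).mkQ (m', 0)) = 0
      simp

lemma ext1Vanish [Module.Projective R Q] (hi : Function.Injective i)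
    (hπ : Function.Surjective π) (hiπ : Function.Exact i π)
    (hT : ∀ X : Type u, Ext1Vanish R T (X →₀ T)) : Ext1Vanish R T (Envelope i M) := by
  refine Ext1Vanish.of_extend .of_projective i π hπ hiπ fun f => ?_
  obtain ⟨q, hq, hqe⟩ := exists_cokernel (M := M) hπ hiπ
  obtain ⟨g, hg⟩ := (hT _).extend i π hi hπ hiπ (q ∘ₗ f)
  obtain ⟨k, hk⟩ := Module.projective_lifting_property q g hq
  obtain ⟨h, hh⟩ := LinearMap.exists_comp_eq_of_injective (unit i M) (unit_injective hi)
    (f - k ∘ₗ i) (fun x => (hqe _).1 (by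
      have := LinearMap.congr_fun hk (i x)
      simp only [LinearMap.comp_apply] at this
      simp [this, hg]))
  refine ⟨k + (envelopeRel i M).mkQ ∘ₗ LinearMap.inr R _ _ ∘ₗ Finsupp.lsingle h, fun x => ?_⟩
  have h1 : (envelopeRel i M).mkQ (0, Finsupp.single h (i x)) = unit i M (h x) := by
    change _ = (envelopeRel i M).mkQ (_, 0)
    rw [← sub_eq_zero, ← map_sub, Prod.mk_sub_mk, mkQ_eq_zero_iff]
    refine ⟨Finsupp.single h (-x), ?_, ?_⟩
    · rw [Finsupp.lsum_single, map_neg, zero_sub]; rfl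
    · rw [Finsupp.mapRange.linearMap_apply, Finsupp.mapRange_single, map_neg,
        Finsupp.single_neg, neg_neg, sub_zero]
  simp only [LinearMap.add_apply, LinearMap.comp_apply, LinearMap.inr_apply,
    Finsupp.lsingle_apply, h1, hh]
  simp

end Envelope

end Envelope

section IsModuleColimit

variable {R : Type u} [CommRing R] {ι : Type u} [Preorder ι]
  {M : ι → Type u} [∀ i, AddCommGroup (M i)] [∀ i, Module R (M i)]

/-- An elementwise characterisation of direct limits. -/
structure IsModuleColimit (f : ∀ i j, i ≤ j → M i →ₗ[R] M j) {L : Type u} [AddCommGroup L]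
    [Module R L] (g : ∀ i, M i →ₗ[R] L) : Prop where
  compat : ∀ i j (h : i ≤ j) x, g j (f i j h x) = g i x
  exists_rep : ∀ l, ∃ i x, g i x = l
  exists_eq_zero : ∀ i x, g i x = 0 → ∃ j h, f i j h x = 0

variable {f : ∀ i j, i ≤ j → M i →ₗ[R] M j} {L : Type u} [AddCommGroup L]
  [Module R L] {g : ∀ i, M i →ₗ[R] L}

variable [IsDirected ι (· ≤ ·)] [Nonempty ι] [DecidableEq ι]

lemma Module.DirectLimit.isModuleColimit [DirectedSystem M fun i j h => f i j h] :
    IsModuleColimit f (Module.DirectLimit.of R ι M f) where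
  compat _ _ _ _ := Module.DirectLimit.of_f
  exists_rep := Module.DirectLimit.exists_of
  exists_eq_zero _ _ h := Module.DirectLimit.of.zero_exact h

lemma IsModuleColimit.nonempty_equiv [DirectedSystem M fun i j h => f i j h]
    (h : IsModuleColimit f g) : Nonempty (Module.DirectLimit M f ≃ₗ[R] L) := by
  refine ⟨LinearEquiv.ofBijective (Module.DirectLimit.lift R ι M f g h.compat) ⟨?_, ?_⟩⟩
  · rw [injective_iff_map_eq_zero]
    intro x hx
    obtain ⟨i, x, rfl⟩ := Module.DirectLimit.exists_of x
    rw [Module.DirectLimit.lift_of] at hx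
    obtain ⟨j, hij, hj⟩ := h.exists_eq_zero i x hx
    rw [← Module.DirectLimit.of_f (hij := hij), hj, map_zero]
  · intro l
    obtain ⟨i, x, rfl⟩ := h.exists_rep l
    exact ⟨Module.DirectLimit.of R ι M f i x, Module.DirectLimit.lift_of _ _ _⟩

end IsModuleColimit

namespace GabrielTopology

variable {R : Type u} [CommRing R] {G : GabrielTopology R}

lemma IsTiltingTopology.exists_presentation (hG : G.IsTiltingTopology) :
    ∃ (P Q T : ModuleCat.{u} R) (i : P →ₗ[R] Q) (π : Q →ₗ[R] T),
      Function.Injective i ∧ Function.Surjective π ∧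
      Function.Exact i π ∧ G.MemA T ∧ G.IsDivisible T ∧
      ∀ (M : Type u) [AddCommGroup M] [Module R M], G.IsDivisible (Envelope i M) := by
  obtain ⟨T, hT, hTA, hTD, h⟩ := hG.exists_tilting
  obtain ⟨ι, p, hp, -⟩ := hT.1
  have hi : Function.Injective (LinearMap.ker p).subtype := Submodule.subtype_injective _
  have hip := LinearMap.exact_subtype_ker_map p
  exact ⟨ModuleCat.of R (LinearMap.ker p), ModuleCat.of R (ι →₀ R), T,
    (LinearMap.ker p).subtype, p, hi, hp, hip, hTA, hTD,
    fun M _ _ => (h _).1 (Envelope.ext1Vanish (P := LinearMap.ker p) hi hp hip hT.2.1)⟩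

/-- Every module has a special `𝒜`-precover. -/
lemma IsTiltingTopology.exists_precover (hG : G.IsTiltingTopology) (M : Type u) [AddCommGroup M]
    [Module R M] : ∃ (X : ModuleCat.{u} R) (φ : X →ₗ[R] M), G.MemA X ∧
      Function.Surjective φ ∧ G.IsDivisible (LinearMap.ker φ) := by
  obtain ⟨P, Q, T, i, π, hi, hπ, hiπ, hTA, hTD, hE⟩ := hG.exists_presentation
  let p : (M →₀ R) →ₗ[R] M := Finsupp.linearCombination R id
  have hp : Function.Surjective p := Finsupp.linearCombination_id_surjective R M
  obtain ⟨q, hq, hqe⟩ := Envelope.exists_cokernel (M := LinearMap.ker p) hπ hiπ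
  obtain ⟨X, j, j', φ, φ', hj, hj', hφ, hφ', hjφ, hjφ'⟩ := LinearMap.exists_pushout
    (K := LinearMap.ker p) (Envelope.unit i (LinearMap.ker p)) q (LinearMap.ker p).subtype p
    (Envelope.unit_injective hi) (Submodule.subtype_injective _) hq hp hqe
    (LinearMap.exact_subtype_ker_map p)
  refine ⟨X, φ, .extension j' φ' hφ' hjφ' hj' .of_projective hTA.finsupp, hφ, ?_⟩
  refine (hE (LinearMap.ker p)).of_surjective
    (j.codRestrict (LinearMap.ker φ) fun x => hjφ.apply_apply_eq_zero x) ?_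
  rintro ⟨x, hx⟩
  obtain ⟨e, rfl⟩ := (hjφ x).1 hx
  exact ⟨e, rfl⟩

section Quotients

variable {ι : Type u} [Preorder ι] [IsDirected ι (· ≤ ·)] [Nonempty ι] [DecidableEq ι]
  {M E : ι → Type u} [∀ i, AddCommGroup (M i)] [∀ i, Module R (M i)]
  [∀ i, AddCommGroup (E i)] [∀ i, Module R (E i)]
  {f : ∀ i j, i ≤ j → M i →ₗ[R] M j}
  {e : ∀ i j, i ≤ j → E i →ₗ[R] E j} [he : DirectedSystem E fun i j h => e i j h]

lemma IsTiltingTopology.memA_directLimit_of_ses (hG : G.IsTiltingTopology)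
    (h : ∀ (M : ι → Type u) [∀ i, AddCommGroup (M i)] [∀ i, Module R (M i)]
      (f : ∀ i j, i ≤ j → M i →ₗ[R] M j) [DirectedSystem M fun i j h => f i j h],
      (∀ i, G.MemA (M i)) → (∀ i, G.IsDivisible (M i)) → G.MemA (Module.DirectLimit M f))
    (u : ∀ i, M i →ₗ[R] E i) (hu : ∀ i j hij x, e i j hij (u i x) = u j (f i j hij x))
    (hui : ∀ i, Function.Injective (u i))
    (hEA : ∀ i, G.MemA (E i)) (hED : ∀ i, G.IsDivisible (E i))
    (hCA : ∀ i, G.MemA (E i ⧸ LinearMap.range (u i))) : G.MemA (Module.DirectLimit M f) := by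
  let c : ∀ i j, i ≤ j →
      (E i ⧸ LinearMap.range (u i)) →ₗ[R] (E j ⧸ LinearMap.range (u j)) := fun i j hij =>
    Submodule.mapQ _ _ (e i j hij) (by
      rintro _ ⟨x, rfl⟩
      exact ⟨f i j hij x, (hu i j hij x).symm⟩)
  have hc : DirectedSystem (fun i => E i ⧸ LinearMap.range (u i)) fun i j h => c i j h := by
    constructor
    · intro i x
      obtain ⟨x, rfl⟩ := Submodule.mkQ_surjective _ x
      exact congrArg (Submodule.mkQ _) (he.map_self x)
    · intro k j i hij hjk x
      obtain ⟨x, rfl⟩ := Submodule.mkQ_surjective _ x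
      exact congrArg (Submodule.mkQ _) (he.map_map hij hjk x)
  let v : Module.DirectLimit M f →ₗ[R] Module.DirectLimit E e :=
    Module.DirectLimit.map u (fun i j hij => LinearMap.ext fun x => (hu i j hij x).symm)
  have hv : ∀ i x, v (Module.DirectLimit.of R ι M f i x) =
      Module.DirectLimit.of R ι E e i (u i x) := fun i x => Module.DirectLimit.map_apply_of _ _ _
  have hvi : Function.Injective v := by
    rw [injective_iff_map_eq_zero]
    intro x hx
    obtain ⟨i, x, rfl⟩ := Module.DirectLimit.exists_of x
    rw [hv] at hx
    obtain ⟨j, hij, hj⟩ := Module.DirectLimit.of.zero_exact hx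
    rw [hu, map_eq_zero_iff _ (hui j)] at hj
    rw [← Module.DirectLimit.of_f (hij := hij), hj, map_zero]
  have hcol : IsModuleColimit (L := Module.DirectLimit E e ⧸ LinearMap.range v) c (fun i =>
      Submodule.mapQ (LinearMap.range (u i)) (LinearMap.range v)
        (Module.DirectLimit.of R ι E e i) (by
          rintro _ ⟨x, rfl⟩
          exact ⟨_, hv i x⟩)) := by
    constructor
    · intro i j hij x
      obtain ⟨x, rfl⟩ := Submodule.mkQ_surjective _ x
      exact congrArg (Submodule.mkQ _) (Module.DirectLimit.of_f (hij := hij) (x := x))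
    · intro l
      obtain ⟨l, rfl⟩ := Submodule.mkQ_surjective _ l
      obtain ⟨i, x, rfl⟩ := Module.DirectLimit.exists_of l
      exact ⟨i, Submodule.mkQ _ x, rfl⟩
    · intro i x hx
      obtain ⟨x, rfl⟩ := Submodule.mkQ_surjective _ x
      obtain ⟨y, hy⟩ := (Submodule.Quotient.mk_eq_zero (LinearMap.range v)).1 hx
      obtain ⟨k, y, rfl⟩ := Module.DirectLimit.exists_of y
      obtain ⟨j, hij, hkj⟩ := exists_ge_ge i k
      rw [hv, ← Module.DirectLimit.of_f (hij := hij),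
        ← Module.DirectLimit.of_f (hij := hkj)] at hy
      obtain ⟨l, hjl, hl⟩ := Module.DirectLimit.exists_eq_of_of_eq hy
      refine ⟨l, hij.trans hjl, (Submodule.Quotient.mk_eq_zero _).2 ⟨f k l (hkj.trans hjl) y, ?_⟩⟩
      rw [← hu]
      have h1 := he.map_map hij hjl x
      have h2 := he.map_map hkj hjl (u k y)
      exact (h2.symm.trans hl).trans h1
  obtain ⟨ε⟩ := hcol.nonempty_equiv
  exact MemA.of_exact hG v (LinearMap.range v).mkQ hvi (Submodule.mkQ_surjective _)
    (LinearMap.exact_map_mkQ_range v) (h E e hEA hED)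
    ((h _ c hCA fun i => (hED i).quotient _).of_linearEquiv ε)

end Quotients

/-- It suffices to check closure under direct limits for systems of divisible modules. -/
lemma IsTiltingTopology.aClosedUnderDirectLimits_of_divisible (hG : G.IsTiltingTopology)
    (h : ∀ (ι : Type u) [Preorder ι] [IsDirected ι (· ≤ ·)] [Nonempty ι] [DecidableEq ι]
      (M : ι → Type u) [∀ i, AddCommGroup (M i)] [∀ i, Module R (M i)]
      (f : ∀ i j, i ≤ j → M i →ₗ[R] M j) [DirectedSystem M fun i j h => f i j h],
      (∀ i, G.MemA (M i)) → (∀ i, G.IsDivisible (M i)) → G.MemA (Module.DirectLimit M f)) :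
    G.AClosedUnderDirectLimits := by
  obtain ⟨P, Q, T, i, π, hi, hπ, hiπ, hTA, hTD, hE⟩ := hG.exists_presentation
  intro ι _ _ _ _ M _ _ f _ hM
  have hEA : ∀ k, G.MemA (Envelope i (M k)) := fun k => by
    obtain ⟨q, hq, hqe⟩ := Envelope.exists_cokernel (M := M k) hπ hiπ
    exact .extension _ q hq hqe (Envelope.unit_injective hi) (hM k) hTA.finsupp
  have hfs : DirectedSystem M fun i j h => f i j h := inferInstance
  have he : DirectedSystem (fun k => Envelope i (M k))
      fun k l h => Envelope.map i (f k l h) := by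
    constructor
    · intro k x
      have : f k k le_rfl = LinearMap.id := LinearMap.ext fun y => hfs.map_self y
      rw [this, Envelope.map_id]
    · intro m l k hkl hlm x
      have : f k m (hkl.trans hlm) = f l m hlm ∘ₗ f k l hkl :=
        LinearMap.ext fun y => (hfs.map_map hkl hlm y).symm
      rw [this, Envelope.map_comp]
  refine hG.memA_directLimit_of_ses (h ι) (e := fun k l h => Envelope.map i (f k l h))
    (fun k => Envelope.unit i (M k)) (fun k l h x => Envelope.map_unit ..)
    (fun k => Envelope.unit_injective hi) hEA (fun k => hE _) fun k => ?_
  obtain ⟨q, hq, hqe⟩ := Envelope.exists_cokernel (M := M k) hπ hiπ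
  exact (hTA.finsupp (ι := P →ₗ[R] M k)).of_linearEquiv
    ((Submodule.quotEquivOfEq _ _ hqe.linearMap_ker_eq.symm).trans
      (q.quotKerEquivOfSurjective hq)).symm

end GabrielTopology

section Shift

open DirectSum

variable {R : Type u} [CommRing R] {ι : Type u} [Preorder ι] [DecidableEq ι]
  {M : ι → Type u} [∀ i, AddCommGroup (M i)] [∀ i, Module R (M i)]
  (f : ∀ i j, i ≤ j → M i →ₗ[R] M j)

namespace Module.DirectLimit

/-- The canonical map from the direct sum onto the direct limit. -/
noncomputable def sumMap : (⨁ i, M i) →ₗ[R] Module.DirectLimit M f :=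
  DirectSum.toModule R ι _ (Module.DirectLimit.of R ι M f)

lemma sumMap_lof (i : ι) (x : M i) :
    sumMap f (DirectSum.lof R ι M i x) = Module.DirectLimit.of R ι M f i x :=
  DirectSum.toModule_lof ..

open Classical in
/-- Push all components with index at most `k` into the `k`-th component. -/
noncomputable def push (k : ι) : (⨁ i, M i) →ₗ[R] ⨁ i, M i :=
  DirectSum.toModule R ι _ fun i =>
    if h : i ≤ k then DirectSum.lof R ι M k ∘ₗ f i k h else DirectSum.lof R ι M i

variable {f}

lemma push_lof_of_le {i k : ι} (h : i ≤ k) (x : M i) :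
    push f k (DirectSum.lof R ι M i x) = DirectSum.lof R ι M k (f i k h x) := by
  rw [push, DirectSum.toModule_lof, dif_pos h]; rfl

lemma push_lof_of_not_le {i k : ι} (h : ¬ i ≤ k) (x : M i) :
    push f k (DirectSum.lof R ι M i x) = DirectSum.lof R ι M i x := by
  rw [push, DirectSum.toModule_lof, dif_neg h]

lemma sumMap_push (k : ι) (x : ⨁ i, M i) : sumMap f (push f k x) = sumMap f x := by
  suffices sumMap f ∘ₗ push f k = sumMap f from LinearMap.congr_fun this x
  ext i x : 2
  simp only [LinearMap.comp_apply]
  by_cases h : i ≤ k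
  · rw [push_lof_of_le h, sumMap_lof, sumMap_lof, Module.DirectLimit.of_f]
  · rw [push_lof_of_not_le h]

variable [IsDirected ι (· ≤ ·)] [Nonempty ι]

lemma sumMap_surjective : Function.Surjective (sumMap f) := fun x => by
  obtain ⟨i, x, rfl⟩ := Module.DirectLimit.exists_of x
  exact ⟨_, sumMap_lof f i x⟩

variable [hf : DirectedSystem M fun i j h => f i j h]

lemma exists_push_eq (y : ⨁ i, M i) : ∃ k z, sumMap f y = Module.DirectLimit.of R ι M f k z ∧
    ∀ l (h : k ≤ l), push f l y = DirectSum.lof R ι M l (f k l h z) := by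
  induction y using DirectSum.induction_on with
  | zero => exact ⟨Classical.arbitrary ι, 0, by simp, by simp⟩
  | of i x =>
    rw [← DirectSum.lof_eq_of R]
    exact ⟨i, x, sumMap_lof f i x, fun l h => push_lof_of_le h x⟩
  | add x y hx hy =>
    obtain ⟨k₁, z₁, h₁, h₁'⟩ := hx
    obtain ⟨k₂, z₂, h₂, h₂'⟩ := hy
    obtain ⟨k, hk₁, hk₂⟩ := exists_ge_ge k₁ k₂
    refine ⟨k, f k₁ k hk₁ z₁ + f k₂ k hk₂ z₂, ?_, fun l h => ?_⟩
    · rw [map_add, h₁, h₂, map_add, Module.DirectLimit.of_f, Module.DirectLimit.of_f]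
    · rw [map_add, h₁' l (hk₁.trans h), h₂' l (hk₂.trans h), map_add, map_add]
      congr 2
      · exact (hf.map_map hk₁ h z₁).symm
      · exact (hf.map_map hk₂ h z₂).symm

lemma exists_push_eq_zero {y : ⨁ i, M i} (hy : sumMap f y = 0) : ∃ k, push f k y = 0 := by
  obtain ⟨k, z, h, h'⟩ := exists_push_eq (f := f) y
  rw [hy] at h
  obtain ⟨l, hl, hz⟩ := Module.DirectLimit.of.zero_exact h.symm
  exact ⟨l, by rw [h' l hl, hz, map_zero]⟩

lemma isDivisible_ker_sumMap {G : GabrielTopology R} (hM : ∀ i, G.IsDivisible (M i)) :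
    G.IsDivisible (LinearMap.ker (sumMap f)) := by
  let g : ∀ p : {p : ι × ι // p.1 ≤ p.2}, M p.1.1 →ₗ[R] ⨁ i, M i := fun p =>
    DirectSum.lof R ι M p.1.2 ∘ₗ f p.1.1 p.1.2 p.2 - DirectSum.lof R ι M p.1.1
  have hg : ∀ p x, g p x ∈ LinearMap.ker (sumMap f) := fun p x => by
    simp only [g, LinearMap.mem_ker, LinearMap.sub_apply, LinearMap.comp_apply, map_sub]
    rw [sumMap_lof, sumMap_lof, Module.DirectLimit.of_f, sub_self]
  refine .of_iSup (fun p => hM p.1.1) (fun p => (g p).codRestrict _ (hg p)) ?_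
  apply Submodule.map_injective_of_injective
    (Submodule.subtype_injective (LinearMap.ker (sumMap f)))
  rw [Submodule.map_iSup, Submodule.map_subtype_top]
  have : ∀ p, Submodule.map (LinearMap.ker (sumMap f)).subtype
      (LinearMap.range ((g p).codRestrict _ (hg p))) = LinearMap.range (g p) := fun p => by
    rw [← LinearMap.range_comp, LinearMap.subtype_comp_codRestrict]
  simp only [this]
  apply le_antisymm
  · refine iSup_le fun p => ?_
    rintro _ ⟨x, rfl⟩
    exact hg p x
  · intro y hy
    obtain ⟨k, hk⟩ := exists_push_eq_zero hy
    have key : ∀ x : ⨁ i, M i, push f k x - x ∈ ⨆ p, LinearMap.range (g p) := by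
      intro x
      induction x using DirectSum.induction_on with
      | zero => simp
      | of i x =>
        rw [← DirectSum.lof_eq_of R]
        by_cases h : i ≤ k
        · rw [push_lof_of_le h]
          exact Submodule.mem_iSup_of_mem ⟨(i, k), h⟩ ⟨x, rfl⟩
        · rw [push_lof_of_not_le h, sub_self]
          exact zero_mem _
      | add x y hx hy =>
        rw [map_add, add_sub_add_comm]
        exact add_mem hx hy
    have := key y
    rw [hk, zero_sub] at this
    exact neg_mem_iff.1 this

end Module.DirectLimit

end Shift

namespace GabrielTopology

variable {R : Type u} [CommRing R] {G : GabrielTopology R}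

open Module.DirectLimit in
lemma IsACovering.aClosedUnderDirectLimits (hG : G.IsTiltingTopology) (h : G.IsACovering) :
    G.AClosedUnderDirectLimits := by
  refine hG.aClosedUnderDirectLimits_of_divisible fun ι _ _ _ _ M _ _ f _ hMA hMD => ?_
  obtain ⟨C, μ, hC, hpre, hcov⟩ := h (Module.DirectLimit M f)
  obtain ⟨s, hs⟩ := Ext1Vanish.lift_ker (sumMap f) (hC _ (isDivisible_ker_sumMap hMD)) μ
    (fun x => sumMap_surjective _)
  obtain ⟨π, hπ⟩ := hpre _ (MemA.directSum hMA) (sumMap f)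
  have hπ' : ∀ x, μ (π x) = sumMap f x := fun x => LinearMap.congr_fun hπ x
  refine hC.of_linearEquiv (LinearEquiv.ofBijective μ ⟨?_, fun l => ?_⟩)
  · rw [injective_iff_map_eq_zero]
    intro x hx
    obtain ⟨k, hk⟩ := exists_push_eq_zero (f := f) (y := s x) (by rw [hs, hx])
    refine (hcov (π ∘ₗ push f k ∘ₗ s) (LinearMap.ext fun y => ?_)).1 ?_
    · simp only [LinearMap.comp_apply]
      rw [hπ', sumMap_push, hs]
    · simp [hk]
  · obtain ⟨x, rfl⟩ := sumMap_surjective l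
    exact ⟨π x, hπ' x⟩

end GabrielTopology

namespace GabrielTopology

variable {R : Type u} [CommRing R] {G : GabrielTopology R}

section Union

variable {S : Type u} [AddCommGroup S] [Module R S] {ι : Type u} [Preorder ι]
  [IsDirected ι (· ≤ ·)] [Nonempty ι]

/-- A directed union of subquotients belonging to `𝒜` belongs to `𝒜`. -/
lemma AClosedUnderDirectLimits.iSup (h : G.AClosedUnderDirectLimits) {W P : ι → Submodule R S}
    (hW : Monotone W) (hP : Monotone P) (hA : ∀ i, G.MemA (W i ⧸ (P i).submoduleOf (W i))) :
    G.MemA (↥(⨆ i, W i) ⧸ (⨆ i, P i).submoduleOf (⨆ i, W i)) := by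
  classical
  let c : ∀ i j, i ≤ j →
      (W i ⧸ (P i).submoduleOf (W i)) →ₗ[R] (W j ⧸ (P j).submoduleOf (W j)) := fun i j hij =>
    Submodule.mapQ _ _ (Submodule.inclusion (hW hij)) fun _ hx => hP hij hx
  have hc : DirectedSystem (fun i => W i ⧸ (P i).submoduleOf (W i)) fun i j h => c i j h := by
    constructor
    · intro i x
      obtain ⟨x, rfl⟩ := Submodule.mkQ_surjective _ x
      rfl
    · intro k j i hij hjk x
      obtain ⟨x, rfl⟩ := Submodule.mkQ_surjective _ x
      rfl
  have hcol : IsModuleColimit (L := ↥(⨆ i, W i) ⧸ (⨆ i, P i).submoduleOf (⨆ i, W i)) c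
      fun i => Submodule.mapQ _ _ (Submodule.inclusion (le_iSup W i))
        fun _ hx => le_iSup P i hx := by
    constructor
    · intro i j hij x
      obtain ⟨x, rfl⟩ := Submodule.mkQ_surjective _ x
      rfl
    · intro l
      obtain ⟨⟨l, hl⟩, rfl⟩ := Submodule.mkQ_surjective _ l
      obtain ⟨i, hi⟩ := (Submodule.mem_iSup_of_directed W hW.directed_le).1 hl
      exact ⟨i, Submodule.mkQ _ ⟨l, hi⟩, rfl⟩
    · intro i x hx
      obtain ⟨⟨x, hxi⟩, rfl⟩ := Submodule.mkQ_surjective _ x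
      have hx' : x ∈ ⨆ i, P i :=
        (Submodule.Quotient.mk_eq_zero ((⨆ i, P i).submoduleOf (⨆ i, W i))).1 hx
      obtain ⟨j, hj⟩ := (Submodule.mem_iSup_of_directed P hP.directed_le).1 hx'
      obtain ⟨k, hik, hjk⟩ := exists_ge_ge i j
      exact ⟨k, hik, (Submodule.Quotient.mk_eq_zero _).2 (hP hjk hj)⟩
  obtain ⟨ε⟩ := hcol.nonempty_equiv
  exact (h ι _ c hA).of_linearEquiv ε

end Union

section Enochs

variable {M X : Type u} [AddCommGroup M] [Module R M] [AddCommGroup X] [Module R X]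

/-- The map `⨁ X → M` induced by `φ : X → M`. -/
noncomputable def sumOver (Λ : Type u) (φ : X →ₗ[R] M) : (Λ →₀ X) →ₗ[R] M :=
  Finsupp.lsum R fun _ => φ

@[simp] lemma sumOver_single {Λ : Type u} (φ : X →ₗ[R] M) (l : Λ) (x : X) :
    sumOver Λ φ (Finsupp.single l x) = φ x := by
  simp [sumOver]

/-- Data presenting an object of `𝒜` over `M` as a quotient of a direct sum of copies of `X`. -/
structure IsAmalgam (G : GabrielTopology R) (φ : X →ₗ[R] M) {Λ : Type u} (J : Set Λ)
    (P : Submodule R (Λ →₀ X)) : Prop where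
  le_supported : P ≤ Finsupp.supported X R J
  le_ker : P ≤ LinearMap.ker (sumOver Λ φ)
  memA : G.MemA (Finsupp.supported X R J ⧸ P.submoduleOf (Finsupp.supported X R J))

/-- A linear map representing a morphism over `M` from an amalgam to `X`. -/
structure IsAmalgamHom (φ : X →ₗ[R] M) {Λ : Type u} (J : Set Λ)
    (P : Submodule R (Λ →₀ X)) (h : (Λ →₀ X) →ₗ[R] X) : Prop where
  eq_zero : ∀ y ∈ P, h y = 0
  comp_eq : ∀ y ∈ Finsupp.supported X R J, φ (h y) = sumOver Λ φ y

/-- The relations obtained by gluing a further copy of `X` along `h`. -/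
noncomputable def glue {Λ : Type u} (J : Set Λ) (h : (Λ →₀ X) →ₗ[R] X) (l : Λ) :
    Submodule R (Λ →₀ X) :=
  (Finsupp.supported X R J).map (LinearMap.id - Finsupp.lsingle l ∘ₗ h)

variable {φ : X →ₗ[R] M} {Λ : Type u} {J : Set Λ} {P : Submodule R (Λ →₀ X)}

lemma sub_single_mem_glue {h : (Λ →₀ X) →ₗ[R] X} {l : Λ} {y : Λ →₀ X}
    (hy : y ∈ Finsupp.supported X R J) : y - Finsupp.single l (h y) ∈ glue J h l :=
  ⟨y, hy, rfl⟩

lemma IsAmalgam.le_glue (hP : IsAmalgam G φ J P) {h : (Λ →₀ X) →ₗ[R] X}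
    (hh : IsAmalgamHom φ J P h) (l : Λ) : P ≤ glue J h l := fun y hy => by
  have := sub_single_mem_glue (h := h) (l := l) (hP.le_supported hy)
  rwa [hh.eq_zero y hy, Finsupp.single_zero, sub_zero] at this

lemma IsAmalgam.exists_hom (hP : IsAmalgam G φ J P)
    (hφ : ∀ (C : Type u) [AddCommGroup C] [Module R C], G.MemA C →
        ∀ f : C →ₗ[R] M, ∃ g : C →ₗ[R] X, ∀ x, φ (g x) = f x) :
    ∃ h, IsAmalgamHom φ J P h := by
  classical
  obtain ⟨g, hg⟩ := hφ _ hP.memA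
    (Submodule.liftQ _ (sumOver Λ φ ∘ₗ (Finsupp.supported X R J).subtype) fun x hx => hP.le_ker hx)
  let ρ : (Λ →₀ X) →ₗ[R] Finsupp.supported X R J := Finsupp.restrictDom X R J
  have hρ : ∀ y (hy : y ∈ Finsupp.supported X R J), ρ y = ⟨y, hy⟩ := fun y hy =>
    LinearMap.congr_fun (Finsupp.restrictDom_comp_subtype J) ⟨y, hy⟩
  refine ⟨g ∘ₗ Submodule.mkQ _ ∘ₗ ρ, fun y hy => ?_, fun y hy => ?_⟩
  · have : Submodule.mkQ (P.submoduleOf (Finsupp.supported X R J)) (ρ y) = 0 := by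
      rw [hρ y (hP.le_supported hy)]
      exact (Submodule.Quotient.mk_eq_zero _).2 hy
    simp only [LinearMap.comp_apply, this, map_zero]
  · simp only [LinearMap.comp_apply, hg, hρ y hy]
    rfl

lemma IsAmalgam.glue (hX : G.MemA X) {h : (Λ →₀ X) →ₗ[R] X}
    (hh : IsAmalgamHom φ J P h) {l : Λ} (hl : l ∉ J) : IsAmalgam G φ (insert l J) (glue J h l) := by
  classical
  have hle : Finsupp.supported X R J ≤ Finsupp.supported X R (insert l J) :=
    Finsupp.supported_mono (Set.subset_insert _ _)
  have hmem : ∀ x, Finsupp.single l x ∈ Finsupp.supported X R (insert l J) := fun x =>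
    Finsupp.single_mem_supported R x (Set.mem_insert _ _)
  refine ⟨?_, ?_, ?_⟩
  · rintro _ ⟨y, hy, rfl⟩
    exact sub_mem (hle hy) (hmem _)
  · rintro _ ⟨y, hy, rfl⟩
    simp [hh.comp_eq y hy]
  · let k : (Λ →₀ X) →ₗ[R] X :=
      h ∘ₗ (Finsupp.supported X R J).subtype ∘ₗ Finsupp.restrictDom X R J + Finsupp.lapply l
    have hk : ∀ y ∈ Finsupp.supported X R J, k y = h y := fun y hy => by
      have h1 : ((Finsupp.restrictDom X R J y : Finsupp.supported X R J) : Λ →₀ X) = y :=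
        congrArg Subtype.val (LinearMap.congr_fun (Finsupp.restrictDom_comp_subtype J) ⟨y, hy⟩)
      have h2 : y l = 0 := by
        by_contra h0
        exact hl (hy (Finsupp.mem_support_iff.2 h0))
      simp [k, h1, h2]
    have hkl : ∀ x, k (Finsupp.single l x) = x := fun x => by
      have : (Finsupp.restrictDom X R J (Finsupp.single l x)) = 0 := by
        ext1
        rw [Finsupp.restrictDom_apply]
        simp [hl]
      simp [k, this]
    let k' := k ∘ₗ (Finsupp.supported X R (insert l J)).subtype
    have hk's : Function.Surjective k' := fun x => ⟨⟨_, hmem x⟩, hkl x⟩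
    refine hX.of_linearEquiv ((k'.quotKerEquivOfSurjective hk's).symm.trans
      (Submodule.quotEquivOfEq _ _ ?_))
    ext ⟨y, hy⟩
    have hdec : y.erase l ∈ Finsupp.supported X R J := by
      intro μ hμ
      rw [Finset.mem_coe, Finsupp.support_erase, Finset.mem_erase] at hμ
      exact (hy hμ.2).resolve_left hμ.1
    have hy' : y.erase l + Finsupp.single l (y l) = y := Finsupp.erase_add_single l y
    change k y = 0 ↔ y ∈ GabrielTopology.glue J h l
    constructor
    · intro h0
      rw [← hy', map_add, hkl, hk _ hdec] at h0
      have := sub_single_mem_glue (h := h) (l := l) hdec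
      rw [eq_neg_of_add_eq_zero_left h0, Finsupp.single_neg, sub_neg_eq_add, hy'] at this
      exact this
    · rintro ⟨z, hz, rfl⟩
      simp [hk z hz, hkl]

lemma AClosedUnderDirectLimits.exists_maximal_amalgam (hcl : G.AClosedUnderDirectLimits)
    (hX : G.MemA X) (φ : X →ₗ[R] M) (Λ : Type u)
    (Θ : Set Λ → Submodule R (Λ →₀ X) → Prop)
    (hΘ : ∀ c : Set (Set Λ × Submodule R (Λ →₀ X)), IsChain (· ≤ ·) c → c.Nonempty →
      (∀ p ∈ c, Θ p.1 p.2) → Θ (⋃ p : c, p.1.1) (⨆ p : c, p.1.2))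
    (h0 : Θ ∅ ⊥) :
    ∃ (J : Set Λ) (P : Submodule R (Λ →₀ X)), IsAmalgam G φ J P ∧ Θ J P ∧
      ∀ h l, IsAmalgamHom φ J P h → Θ (insert l J) (GabrielTopology.glue J h l) → l ∈ J := by
  have hstart : IsAmalgam G φ (∅ : Set Λ) (⊥ : Submodule R (Λ →₀ X)) := by
    refine ⟨bot_le, bot_le, ?_⟩
    rw [Finsupp.supported_empty]
    exact .of_subsingleton
  obtain ⟨⟨J, P⟩, -, hm⟩ := zorn_le_nonempty₀
    {p : Set Λ × Submodule R (Λ →₀ X) | IsAmalgam G φ p.1 p.2 ∧ Θ p.1 p.2}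
    (fun c hc hchain p hp => by
      have : Nonempty c := ⟨⟨p, hp⟩⟩
      have : IsDirected c (· ≤ ·) := ⟨fun a b => by
        rcases hchain.total a.2 b.2 with h | h
        · exact ⟨b, h, le_rfl⟩
        · exact ⟨a, le_rfl, h⟩⟩
      refine ⟨(⋃ p : c, p.1.1, ⨆ p : c, p.1.2), ⟨⟨?_, ?_, ?_⟩,
        hΘ c hchain ⟨p, hp⟩ fun p hp => (hc hp).2⟩, fun z hz =>
          ⟨fun x hx => Set.mem_iUnion.2 ⟨⟨z, hz⟩, hx⟩, le_iSup (fun p : c => p.1.2) ⟨z, hz⟩⟩⟩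
      · exact iSup_le fun p => (hc p.2).1.le_supported.trans
          (Finsupp.supported_mono (Set.subset_iUnion (fun p : c => p.1.1) p))
      · exact iSup_le fun p => (hc p.2).1.le_ker
      · have := hcl.iSup (W := fun p : c => Finsupp.supported X R p.1.1) (P := fun p => p.1.2)
          (fun a b hab => Finsupp.supported_mono hab.1) (fun a b hab => hab.2)
          fun p => (hc p.2).1.memA
        rw [← Finsupp.supported_iUnion] at this
        exact this) (∅, ⊥) ⟨hstart, h0⟩
  refine ⟨J, P, hm.prop.1, hm.prop.2, fun h l hh hl => ?_⟩
  by_contra hlJ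
  exact hlJ ((hm.le_of_ge (y := (insert l J, GabrielTopology.glue J h l)) ⟨.glue hX hh hlJ, hl⟩
    ⟨Set.subset_insert _ _, hm.prop.1.le_glue hh l⟩).1 (Set.mem_insert _ _))

lemma AClosedUnderDirectLimits.exists_precover_injective (hcl : G.AClosedUnderDirectLimits)
    (hX : G.MemA X) (φ : X →ₗ[R] M)
    (hφ : ∀ (C : Type u) [AddCommGroup C] [Module R C], G.MemA C →
        ∀ f : C →ₗ[R] M, ∃ g : C →ₗ[R] X, ∀ x, φ (g x) = f x) :
    ∃ (Z : ModuleCat.{u} R) (ψ : Z →ₗ[R] M), G.MemA Z ∧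
      (∀ (C : Type u) [AddCommGroup C] [Module R C], G.MemA C →
        ∀ f : C →ₗ[R] M, ∃ g : C →ₗ[R] Z, ∀ x, ψ (g x) = f x) ∧
      ∀ (C : Type u) [AddCommGroup C] [Module R C], G.MemA C →
        ∀ (f : C →ₗ[R] M) (g : Z →ₗ[R] C), (∀ x, f (g x) = ψ x) → Function.Injective g := by
  classical
  obtain ⟨J, P, hP, ⟨hJ, hrep⟩, hmax⟩ := hcl.exists_maximal_amalgam hX φ (List X)
    (fun J P => (∀ x μ, x :: μ ∈ J → μ ∈ J ∧ Finsupp.single μ x ∈ P) ∧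
      ∀ y ∈ Finsupp.supported X R J, ∃ μ x, y - Finsupp.single μ x ∈ P) (by
      intro c hchain hne hc
      have : Nonempty c := hne.to_subtype
      have hdir : Directed (· ≤ ·) fun p : c => (p : Set (List X) × Submodule R (List X →₀ X)) :=
        hchain.directed
      constructor
      · intro x μ h
        obtain ⟨p, hp⟩ := Set.mem_iUnion.1 h
        obtain ⟨h1, h2⟩ := (hc _ p.2).1 x μ hp
        exact ⟨Set.mem_iUnion.2 ⟨p, h1⟩, Submodule.mem_iSup_of_mem p h2⟩
      · intro y hy
        rw [Finsupp.supported_iUnion, Submodule.mem_iSup_of_directed _ fun a b => by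
          obtain ⟨d, h1, h2⟩ := hdir a b
          exact ⟨d, Finsupp.supported_mono h1.1, Finsupp.supported_mono h2.1⟩] at hy
        obtain ⟨p, hp⟩ := hy
        obtain ⟨μ, x, h⟩ := (hc _ p.2).2 y hp
        exact ⟨μ, x, Submodule.mem_iSup_of_mem p h⟩)
    ⟨fun _ _ h => h.elim, fun y hy => ⟨[], 0, by simpa using hy⟩⟩
  have hext : ∀ h, IsAmalgamHom φ J P h → ∀ l,
      (∀ x μ, l = x :: μ → μ ∈ J ∧ h (Finsupp.single μ x) = 0) → l ∈ J := by
    intro h hh l hl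
    refine hmax h l hh ⟨?_, ?_⟩
    · rintro x μ (h' | h')
      · obtain ⟨h1, h2⟩ := hl x μ h'.symm
        refine ⟨.inr h1, ?_⟩
        have := sub_single_mem_glue (h := h) (l := l) (Finsupp.single_mem_supported R x h1)
        rwa [h2, Finsupp.single_zero, sub_zero] at this
      · obtain ⟨h1, h2⟩ := hJ x μ h'
        exact ⟨.inr h1, hP.le_glue hh l h2⟩
    · intro y hy
      have hdec : y.erase l ∈ Finsupp.supported X R J := by
        intro μ hμ
        rw [Finset.mem_coe, Finsupp.support_erase, Finset.mem_erase] at hμ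
        exact (hy hμ.2).resolve_left hμ.1
      refine ⟨l, y l + h (y.erase l), ?_⟩
      have := sub_single_mem_glue (h := h) (l := l) hdec
      rwa [Finsupp.single_add, sub_add_eq_sub_sub,
        sub_eq_of_eq_add (Finsupp.erase_add_single l y).symm]
  obtain ⟨h₀, hh₀⟩ := hP.exists_hom hφ
  have hnil : [] ∈ J := hext h₀ hh₀ [] (by simp)
  have hinj : ∀ h, IsAmalgamHom φ J P h → ∀ y ∈ Finsupp.supported X R J, h y = 0 → y ∈ P := by
    intro h hh y hy hy0
    obtain ⟨μ, x, hx⟩ := hrep y hy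
    by_cases hx0 : x = 0
    · simpa [hx0] using hx
    have hs : Finsupp.single μ x ∈ Finsupp.supported X R J := by
      simpa using sub_mem hy (hP.le_supported hx)
    have hμ : μ ∈ J := hs (by simp [hx0])
    have hz : h (Finsupp.single μ x) = 0 := by
      have := hh.eq_zero _ hx
      rwa [map_sub, hy0, zero_sub, neg_eq_zero] at this
    have := hJ x μ (hext h hh (x :: μ) (by
      rintro x' μ' h'
      obtain ⟨rfl, rfl⟩ := List.cons.inj h'
      exact ⟨hμ, hz⟩))
    simpa using add_mem hx this.2
  let ψ : (Finsupp.supported X R J ⧸ P.submoduleOf (Finsupp.supported X R J)) →ₗ[R] M :=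
    Submodule.liftQ _ (sumOver _ φ ∘ₗ (Finsupp.supported X R J).subtype) fun x hx => hP.le_ker hx
  let incl : X →ₗ[R] (Finsupp.supported X R J ⧸ P.submoduleOf (Finsupp.supported X R J)) :=
    Submodule.mkQ _ ∘ₗ (Finsupp.lsingle []).codRestrict (Finsupp.supported X R J)
      fun x => Finsupp.single_mem_supported R x hnil
  refine ⟨ModuleCat.of R _, ψ, hP.memA, fun C _ _ hC f => ?_, fun C _ _ hC f g hg => ?_⟩
  · obtain ⟨g, hg⟩ := hφ C hC f
    refine ⟨incl ∘ₗ g, fun x => ?_⟩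
    rw [← hg]
    exact sumOver_single φ [] (g x)
  · obtain ⟨k, hk⟩ := hφ C hC f
    let ρ : (List X →₀ X) →ₗ[R] Finsupp.supported X R J := Finsupp.restrictDom X R J
    have hρ : ∀ y (hy : y ∈ Finsupp.supported X R J), ρ y = ⟨y, hy⟩ := fun y hy =>
      LinearMap.congr_fun (Finsupp.restrictDom_comp_subtype J) ⟨y, hy⟩
    have hh : IsAmalgamHom φ J P (k ∘ₗ g ∘ₗ Submodule.mkQ _ ∘ₗ ρ) := by
      refine ⟨fun y hy => ?_, fun y hy => ?_⟩
      · have : Submodule.mkQ (P.submoduleOf (Finsupp.supported X R J)) (ρ y) = 0 := by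
          rw [hρ y (hP.le_supported hy)]
          exact (Submodule.Quotient.mk_eq_zero _).2 hy
        simp only [LinearMap.comp_apply, this, map_zero]
      · simp only [LinearMap.comp_apply, hρ y hy, hk]
        exact hg _
    rw [injective_iff_map_eq_zero]
    intro y hy
    obtain ⟨⟨y, hyJ⟩, rfl⟩ := Submodule.mkQ_surjective _ y
    refine (Submodule.Quotient.mk_eq_zero _).2 (hinj _ hh y hyJ ?_)
    simp only [LinearMap.comp_apply, hρ y hyJ]
    exact (congrArg k hy).trans (map_zero k)

lemma AClosedUnderDirectLimits.isACovering (hG : G.IsTiltingTopology)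
    (hcl : G.AClosedUnderDirectLimits) : G.IsACovering := by
  intro M _ _
  obtain ⟨X, φ, hX, hφs, hφk⟩ := hG.exists_precover M
  obtain ⟨Z, ψ, hZ, hψ, hinj⟩ := hcl.exists_precover_injective hX φ fun C _ _ hC f => by
    exact Ext1Vanish.lift_ker φ (hC _ hφk) f fun x => hφs _
  refine ⟨Z, ψ, hZ, fun C _ _ hC f => ?_, fun e he => ⟨?_, ?_⟩⟩
  · obtain ⟨g, hg⟩ := hψ C hC f
    exact ⟨g, LinearMap.ext hg⟩
  · exact hinj Z hZ ψ e (LinearMap.congr_fun he)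
  by_contra hsurj
  simp only [Function.Surjective, not_forall, not_exists] at hsurj
  obtain ⟨c, hc⟩ := hsurj
  obtain ⟨J, P, hP, hJ, hmax⟩ := hcl.exists_maximal_amalgam hZ ψ (Set Z)
    (fun J P => ∀ l ∈ J, ∀ μ ∈ J, l ≠ μ → ∃ z, z ≠ c ∧
      (Finsupp.single l c - Finsupp.single μ z ∈ P ∨ Finsupp.single μ c - Finsupp.single l z ∈ P))
    (by
      intro s hchain hne hs l hl μ hμ hlμ
      obtain ⟨p, hp⟩ := Set.mem_iUnion.1 hl
      obtain ⟨q, hq⟩ := Set.mem_iUnion.1 hμ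
      obtain ⟨d, h1, h2⟩ := hchain.directed p q
      obtain ⟨z, hz, h⟩ := hs _ d.2 l (h1.1 hp) μ (h2.1 hq) hlμ
      exact ⟨z, hz, h.imp (Submodule.mem_iSup_of_mem d) (Submodule.mem_iSup_of_mem d)⟩)
    (fun _ h => h.elim)
  obtain ⟨h, hh⟩ := hP.exists_hom hψ
  have heh : IsAmalgamHom ψ J P (e ∘ₗ h) :=
    ⟨fun y hy => by simp [hh.eq_zero y hy], fun y hy =>
      (LinearMap.congr_fun he (h y)).trans (hh.comp_eq y hy)⟩
  have huniv : ∀ l, l ∈ J := by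
    intro l
    refine hmax (e ∘ₗ h) l heh ?_
    have key : ∀ μ ∈ J, Finsupp.single μ c - Finsupp.single l (e (h (Finsupp.single μ c))) ∈
        glue J (e ∘ₗ h) l := fun μ hμ => sub_single_mem_glue (Finsupp.single_mem_supported R c hμ)
    rintro l₁ (rfl | h₁) l₂ (rfl | h₂) hne
    · exact absurd rfl hne
    · exact ⟨_, hc _, .inr (key l₂ h₂)⟩
    · exact ⟨_, hc _, .inl (key l₁ h₁)⟩
    · obtain ⟨z, hz, h'⟩ := hJ l₁ h₁ l₂ h₂ hne
      exact ⟨z, hz, h'.imp (fun h => hP.le_glue heh l h) fun h => hP.le_glue heh l h⟩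
  have hcopy : ∀ l z, h (Finsupp.single l z) = h (Finsupp.single l c) → z = c := fun l z hz =>
    hinj Z hZ ψ (h ∘ₗ Finsupp.lsingle l) (fun x => by
      simpa using hh.comp_eq _ (Finsupp.single_mem_supported R x (huniv l))) hz
  refine Function.cantor_injective (fun l : Set Z => h (Finsupp.single l c)) fun l μ hlμ => ?_
  by_contra hne
  obtain ⟨z, hz, h' | h'⟩ := hJ l (huniv l) μ (huniv μ) hne
  · have := hh.eq_zero _ h'
    rw [map_sub, sub_eq_zero] at this
    exact hz (hcopy μ z (this.symm.trans hlμ))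
  · have := hh.eq_zero _ h'
    rw [map_sub, sub_eq_zero] at this
    exact hz (hcopy l z (this.symm.trans hlμ.symm))

end Enochs

end GabrielTopology

namespace IsModuleColimit

variable {R : Type u} [CommRing R] {ι : Type u} [Preorder ι] [IsDirected ι (· ≤ ·)] [Nonempty ι]
  {M : ι → Type u} [∀ i, AddCommGroup (M i)] [∀ i, Module R (M i)]
  {f : ∀ i j, i ≤ j → M i →ₗ[R] M j} {L : Type u} [AddCommGroup L]
  [Module R L] {g : ∀ i, M i →ₗ[R] L}

lemma exists_rep_of_finite (h : IsModuleColimit f g) {κ : Type*} [Finite κ] (x : κ → L) :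
    ∃ i, ∃ y : κ → M i, ∀ k, g i (y k) = x k := by
  choose i y hy using fun k => h.exists_rep (x k)
  obtain ⟨j, hj⟩ := Finite.exists_le i
  exact ⟨j, fun k => f _ _ (hj k) (y k), fun k => by rw [h.compat, hy]⟩

lemma flat (h : IsModuleColimit f g) (hM : ∀ i, Module.Flat R (M i)) : Module.Flat R L := by
  refine Module.Flat.of_forall_isTrivialRelation fun {l r x} hx => ?_
  obtain ⟨i, y, hy⟩ := h.exists_rep_of_finite x
  obtain ⟨j, hij, hj⟩ := h.exists_eq_zero i (∑ k, r k • y k) (by simp [hy, hx])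
  rw [map_sum] at hj
  simp only [map_smul] at hj
  obtain ⟨k, a, z, h1, h2⟩ := Module.Flat.isTrivialRelation_of_sum_smul_eq_zero hj
  refine ⟨k, a, fun k => g j (z k), fun m => ?_, h2⟩
  rw [← hy, ← h.compat i j hij, show f i j hij (y m) = ∑ j, a m j • z j from h1 m, map_sum]
  simp

end IsModuleColimit

section Telescope

variable {R : Type u} [CommRing R] (N D : Type u) [AddCommGroup N] [Module R N] [AddCommGroup D]
  [Module R D] (a : ℕ → R)

/-- The map whose cokernel is the direct limit of `N → N → N → ⋯`, the transition maps being
multiplication by `a 0`, `a 1`, …. -/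
noncomputable def telescope : (ℕ →₀ N) →ₗ[R] (ℕ →₀ N) :=
  LinearMap.id - Finsupp.lsum R fun n => Finsupp.lsingle (n + 1) ∘ₗ LinearMap.lsmul R N (a n)

lemma telescope_single (n : ℕ) (x : N) : telescope N a (Finsupp.single n x) =
    Finsupp.single n x - Finsupp.single (n + 1) (a n • x) := by
  simp [telescope]

lemma telescope_apply_zero (y : ℕ →₀ N) : telescope N a y 0 = y 0 := by
  induction y using Finsupp.induction_linear with
  | zero => simp
  | add x y hx hy => simp [hx, hy]
  | single n x => simp [telescope_single]

lemma telescope_apply_succ (y : ℕ →₀ N) (k : ℕ) :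
    telescope N a y (k + 1) = y (k + 1) - a k • y k := by
  induction y using Finsupp.induction_linear with
  | zero => simp
  | add x y hx hy =>
    simp only [map_add, Finsupp.add_apply, hx, hy, smul_add]
    abel
  | single n x =>
    rw [telescope_single]
    by_cases h : n = k
    · subst h; simp
    · simp [Finsupp.single_apply, h]

lemma telescope_injective : Function.Injective (telescope N a) := by
  rw [injective_iff_map_eq_zero]
  intro y hy
  ext k
  induction k with
  | zero => rw [← telescope_apply_zero N a y, hy]
  | succ k ih =>
    have := telescope_apply_succ N a y k
    rw [hy, ih] at this
    simpa using this.symm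

lemma telescope_isModuleColimit :
    ∃ (f : ∀ i j : ULift.{u} ℕ, i ≤ j → N →ₗ[R] N)
      (g : ∀ _ : ULift.{u} ℕ, N →ₗ[R] ((ℕ →₀ N) ⧸ LinearMap.range (telescope N a))),
      DirectedSystem (fun _ => N) (fun i j h => f i j h) ∧ IsModuleColimit f g := by
  let T := LinearMap.range (telescope N a)
  let c : ℕ → ℕ → R := fun i j => ∏ k ∈ Finset.Ico i j, a k
  have hstep : ∀ i j, i ≤ j → ∀ x : N, Submodule.mkQ T (Finsupp.single j (c i j • x)) =
      Submodule.mkQ T (Finsupp.single i x) := by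
    intro i j hij
    induction j, hij using Nat.le_induction with
    | base => simp [c]
    | succ j hij ih =>
      intro x
      rw [← ih x, eq_comm, ← sub_eq_zero, ← map_sub]
      refine (Submodule.Quotient.mk_eq_zero _).2 ⟨Finsupp.single j (c i j • x), ?_⟩
      rw [telescope_single, smul_smul, show c i (j + 1) = a j * c i j by
        simp only [c]; rw [Finset.prod_Ico_succ_top hij, mul_comm]]
  refine ⟨fun i j _ => LinearMap.lsmul R N (c i.down j.down),
    fun i => Submodule.mkQ T ∘ₗ Finsupp.lsingle i.down, ⟨fun i x => by simp [c],
      fun k j i hij hjk x => ?_⟩, fun i j h x => hstep _ _ h x, fun l => ?_, fun i x hx => ?_⟩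
  · simp only [LinearMap.lsmul_apply, smul_smul, c]
    rw [mul_comm, Finset.prod_Ico_consecutive _ hij hjk]
  · obtain ⟨y, rfl⟩ := Submodule.mkQ_surjective _ l
    induction y using Finsupp.induction_linear with
    | zero => exact ⟨⟨0⟩, 0, by simp⟩
    | add y z hy hz =>
      obtain ⟨⟨i⟩, x, hx⟩ := hy
      obtain ⟨⟨j⟩, w, hw⟩ := hz
      refine ⟨⟨max i j⟩, c i (max i j) • x + c j (max i j) • w, ?_⟩
      rw [map_add, map_add, ← hx, ← hw]
      exact congrArg₂ (· + ·) (hstep i _ (le_max_left _ _) x) (hstep j _ (le_max_right _ _) w)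
    | single n x => exact ⟨⟨n⟩, x, rfl⟩
  · obtain ⟨i⟩ := i
    obtain ⟨y, hy⟩ := (Submodule.Quotient.mk_eq_zero T).1 hx
    have hy : telescope N a y = Finsupp.single i x := hy
    have h0 : ∀ k, y k = if i ≤ k then c i k • x else 0 := by
      intro k
      induction k with
      | zero =>
        rw [← telescope_apply_zero N a y, hy, Finsupp.single_apply]
        rcases Nat.eq_zero_or_pos i with rfl | h
        · simp [c]
        · simp [h.ne']
      | succ k ih =>
        have := telescope_apply_succ N a y k
        rw [hy, ih, eq_sub_iff_add_eq] at this
        rw [← this, Finsupp.single_apply]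
        rcases lt_trichotomy i (k + 1) with h | rfl | h
        · have h' : i ≤ k := Nat.lt_succ_iff.1 h
          simp only [h.ne, h', h.le, if_true, if_false, zero_add, smul_smul, c]
          rw [Finset.prod_Ico_succ_top h', mul_comm]
        · simp [c]
        · simp [h.ne', show ¬ i ≤ k by omega, show ¬ i ≤ k + 1 by omega]
    obtain ⟨j, hij, hj⟩ : ∃ j, i ≤ j ∧ y j = 0 := by
      refine ⟨max i (y.support.sup id + 1), le_max_left _ _, ?_⟩
      by_contra h
      have := Finset.le_sup (f := id) (Finsupp.mem_support_iff.2 h)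
      simp only [id] at this
      omega
    refine ⟨⟨j⟩, hij, ?_⟩
    have := h0 j
    rw [if_pos hij, hj] at this
    exact this.symm

variable {N D} {a}

lemma exists_prod_smul_eq_of_extend (hext : ∀ f : (ℕ →₀ N) →ₗ[R] (ℕ →₀ D),
      ∃ h : (ℕ →₀ N) →ₗ[R] (ℕ →₀ D), ∀ y, h (telescope N a y) = f y) (g : N →ₗ[R] D) (x : N) :
    ∃ (n : ℕ) (w : N →ₗ[R] D),
      (∏ k ∈ Finset.range n, a k) • g x = (∏ k ∈ Finset.range (n + 1), a k) • w x := by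
  obtain ⟨h, hh⟩ := hext (Finsupp.mapRange.linearMap g)
  have hrec : ∀ n z, h (Finsupp.single n z) =
      Finsupp.single n (g z) + a n • h (Finsupp.single (n + 1) z) := fun n z => by
    have := hh (Finsupp.single n z)
    rw [telescope_single, map_sub, ← Finsupp.smul_single, map_smul,
      Finsupp.mapRange.linearMap_apply, Finsupp.mapRange_single] at this
    rw [← this]
    abel
  have key : ∀ n, ∃ y : ℕ →₀ D, (∀ k, n ≤ k → y k = 0) ∧
      h (Finsupp.single 0 x) = y + (∏ k ∈ Finset.range n, a k) • h (Finsupp.single n x) := by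
    intro n
    induction n with
    | zero => exact ⟨0, by simp, by simp⟩
    | succ n ih =>
      obtain ⟨y, hy, h'⟩ := ih
      refine ⟨y + (∏ k ∈ Finset.range n, a k) • Finsupp.single n (g x), fun k hk => ?_, ?_⟩
      · simp [hy k (by omega), show n ≠ k by omega]
      · rw [h', hrec n x, Finset.prod_range_succ, smul_add, smul_smul, add_assoc]
  obtain ⟨n, hn⟩ : ∃ n, h (Finsupp.single 0 x) n = 0 := by
    refine ⟨(h (Finsupp.single 0 x)).support.sup id + 1, ?_⟩
    by_contra h'
    have := Finset.le_sup (f := id) (Finsupp.mem_support_iff.2 h')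
    simp only [id] at this
    omega
  refine ⟨n, -(Finsupp.lapply n ∘ₗ h ∘ₗ Finsupp.lsingle (n + 1)), ?_⟩
  obtain ⟨y, hy, h'⟩ := key n
  rw [h', hrec n x] at hn
  simp only [Finsupp.add_apply, Finsupp.smul_apply, hy n le_rfl, Finsupp.single_eq_same, zero_add,
    smul_add, smul_smul, ← Finset.prod_range_succ] at hn
  rw [eq_neg_of_add_eq_zero_left hn]
  simp

end Telescope

lemma GabrielTopology.AClosedUnderDirectLimits.exists_prod_smul_eq {R : Type u} [CommRing R]
    {G : GabrielTopology R} (hcl : G.AClosedUnderDirectLimits) {N D : Type u} [AddCommGroup N]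
    [Module R N] [AddCommGroup D] [Module R D] (hN : G.MemA N) (hD : G.IsDivisible D)
    (a : ℕ → R) (g : N →ₗ[R] D) (x : N) :
    ∃ (n : ℕ) (w : N →ₗ[R] D),
      (∏ k ∈ Finset.range n, a k) • g x = (∏ k ∈ Finset.range (n + 1), a k) • w x := by
  classical
  refine exists_prod_smul_eq_of_extend (fun f => ?_) g x
  obtain ⟨c, d, _, h⟩ := telescope_isModuleColimit N a
  obtain ⟨ε⟩ := h.nonempty_equiv
  have hC : G.MemA ((ℕ →₀ N) ⧸ LinearMap.range (telescope N a)) :=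
    (hcl _ _ c fun _ => hN).of_linearEquiv ε
  have hDD : G.IsDivisible (ℕ →₀ D) := .of_iSup (fun _ : ℕ => hD) (fun i => Finsupp.lsingle i)
    Finsupp.iSup_lsingle_range
  exact (hC _ hDD).extend _ _ (telescope_injective N a) (Submodule.mkQ_surjective _)
    (LinearMap.exact_map_mkQ_range _) f

/-- In a perfect ring, the sequence of ideals `(a 0 ⋯ a n)` is stationary. -/
lemma IsPerfectRing.exists_prod_eq {S : Type u} [CommRing S] (hS : IsPerfectRing S) (a : ℕ → S) :
    ∃ n r, ∏ k ∈ Finset.range n, a k = (∏ k ∈ Finset.range (n + 1), a k) * r := by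
  obtain ⟨n, w, h⟩ := exists_prod_smul_eq_of_extend (N := S) (D := S) (a := a) (fun f => by
    obtain ⟨c, d, _, h⟩ := telescope_isModuleColimit S a
    have := hS _ (h.flat fun _ => inferInstance)
    obtain ⟨σ, hσ⟩ := Module.projective_lifting_property
      (LinearMap.range (telescope S a)).mkQ LinearMap.id (Submodule.mkQ_surjective _)
    obtain ⟨k, hk⟩ := LinearMap.exists_comp_eq_of_injective (telescope S a)
      (telescope_injective S a) (LinearMap.id - σ ∘ₗ Submodule.mkQ _) fun z => by
        refine (Submodule.Quotient.mk_eq_zero (LinearMap.range (telescope S a))).1 ?_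
        have := LinearMap.congr_fun hσ (Submodule.mkQ _ z)
        exact (map_sub (LinearMap.range (telescope S a)).mkQ z _).trans (sub_eq_zero.2 this.symm)
    refine ⟨f ∘ₗ k, fun y => congrArg f (telescope_injective S a ?_)⟩
    rw [hk]
    have : (LinearMap.range (telescope S a)).mkQ (telescope S a y) = 0 :=
      (Submodule.Quotient.mk_eq_zero _).2 ⟨y, rfl⟩
    simp [this]) LinearMap.id 1
  exact ⟨n, w 1, by simpa using h⟩

/-- Every sequence of ideals of the form `(a 0 ⋯ a n)` is stationary. -/
def ProductChainCondition (S : Type u) [CommRing S] : Prop :=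
  ∀ a : ℕ → S, ∃ n r, ∏ k ∈ Finset.range n, a k = (∏ k ∈ Finset.range (n + 1), a k) * r

namespace ProductChainCondition

variable {S : Type u} [CommRing S]

lemma of_surjective {T : Type u} [CommRing T] (h : ProductChainCondition S) (f : S →+* T)
    (hf : Function.Surjective f) : ProductChainCondition T := fun a => by
  choose b hb using fun n => hf (a n)
  obtain ⟨n, r, hr⟩ := h b
  exact ⟨n, f r, by simpa [hb] using congrArg f hr⟩

lemma subsingleton_of_le_smul [IsLocalRing S] (h : ProductChainCondition S) {N : Type u}
    [AddCommGroup N] [Module S N]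
    (hN : (⊤ : Submodule S N) ≤ IsLocalRing.maximalIdeal S • (⊤ : Submodule S N)) :
    Subsingleton N := by
  by_contra hne
  rw [not_subsingleton_iff_nontrivial] at hne
  obtain ⟨x, hx⟩ := exists_ne (0 : N)
  let Q := {q : S × N // q.1 • q.2 ≠ 0}
  have step : ∀ q : Q, ∃ (m : S) (q' : Q), m ∈ IsLocalRing.maximalIdeal S ∧
      q'.1.1 = q.1.1 * m := by
    rintro ⟨⟨p, y⟩, hy⟩
    by_contra! hcon
    refine hy ?_
    have : y ∈ LinearMap.ker (LinearMap.lsmul S N p) := by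
      have hle : IsLocalRing.maximalIdeal S • (⊤ : Submodule S N) ≤
          LinearMap.ker (LinearMap.lsmul S N p) := by
        refine Submodule.smul_le.2 fun m hm z _ => ?_
        simp only [LinearMap.mem_ker, LinearMap.lsmul_apply, smul_smul]
        by_contra h0
        exact hcon m ⟨(p * m, z), h0⟩ hm rfl
      exact hle (hN trivial)
    exact this
  choose m nxt hm hnxt using step
  let q : ℕ → Q := fun n => Nat.rec ⟨(1, x), by simpa using hx⟩ (fun _ q => nxt q) n
  have hq : ∀ n, (q n).1.1 = ∏ k ∈ Finset.range n, m (q k) := by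
    intro n
    induction n with
    | zero => rfl
    | succ n ih => rw [Finset.prod_range_succ, ← ih]; exact hnxt (q n)
  obtain ⟨n, r, hr⟩ := h fun k => m (q k)
  rw [Finset.prod_range_succ, ← hq] at hr
  have hu : IsUnit (1 - m (q n) * r) :=
    (IsLocalRing.isUnit_or_isUnit_one_sub_self (m (q n) * r)).resolve_left
      ((IsLocalRing.maximalIdeal S).mul_mem_right r (hm _))
  have h0 : (q n).1.1 * (1 - m (q n) * r) = 0 := by
    rw [mul_sub, mul_one, ← mul_assoc, ← hr, sub_self]
  exact (q n).2 (by rw [hu.mul_left_eq_zero.1 h0, zero_smul])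

open TensorProduct IsLocalRing in
lemma projective_of_isLocalRing [IsLocalRing S] (h : ProductChainCondition S) (F : Type u)
    [AddCommGroup F] [Module S F] [Module.Flat S F] : Module.Projective S F := by
  let w := Module.Free.chooseBasis (ResidueField S) (ResidueField S ⊗[S] F)
  have ⟨v, eq⟩ := (TensorProduct.mk_surjective S F (ResidueField S)
    Ideal.Quotient.mk_surjective).comp_left w
  have eq' : TensorProduct.mk S (ResidueField S) F 1 ∘ v = w := eq
  have hli : LinearIndependent S v :=
    Module.IsLocalRing.linearIndependent_of_flat _ (eq' ▸ w.linearIndependent)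
  refine .of_basis (.mk hli ?_)
  have hsub : Subsingleton (F ⧸ Submodule.span S (Set.range v)) := by
    refine h.subsingleton_of_le_smul fun x _ => ?_
    obtain ⟨x, rfl⟩ := Submodule.mkQ_surjective _ x
    have h1 : TensorProduct.mk S (ResidueField S) F 1 x ∈
        (Submodule.span (ResidueField S) (Set.range w)).restrictScalars S := by
      rw [w.span_eq]; trivial
    rw [Submodule.restrictScalars_span S (ResidueField S) Ideal.Quotient.mk_surjective, ← eq',
      Set.range_comp, Submodule.span_image] at h1
    obtain ⟨n, hn, hnx⟩ := h1
    have h2 : x - n ∈ maximalIdeal S • (⊤ : Submodule S F) := by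
      rw [← LinearMap.ker_tensorProductMk, LinearMap.mem_ker, map_sub, sub_eq_zero]
      exact hnx.symm
    have h3 : Submodule.mkQ (Submodule.span S (Set.range v)) x =
        Submodule.mkQ (Submodule.span S (Set.range v)) (x - n) := by
      rw [map_sub, eq_comm, sub_eq_self]
      exact (Submodule.Quotient.mk_eq_zero _).2 hn
    rw [h3]
    have h4 := Submodule.mem_map_of_mem (f := Submodule.mkQ (Submodule.span S (Set.range v))) h2
    rw [Submodule.map_smul''] at h4
    exact Submodule.smul_mono le_rfl le_top h4
  exact (Submodule.Quotient.subsingleton_iff.1 hsub).ge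

variable (S) in
/-- Multiplication by `e` on `F` factors through a projective module. -/
def FactorsThroughProjective (F : Type u) [AddCommGroup F] [Module S F] (e : S) : Prop :=
  ∃ (P : Type u) (_ : AddCommGroup P) (_ : Module S P) (s : F →ₗ[S] P) (r : P →ₗ[S] F),
    Module.Projective S P ∧ ∀ x, r (s x) = e • x

variable {F : Type u} [AddCommGroup F] [Module S F]

lemma FactorsThroughProjective.add {e f : S} (he : FactorsThroughProjective S F e)
    (hf : FactorsThroughProjective S F f) : FactorsThroughProjective S F (e + f) := by
  obtain ⟨P, _, _, s, r, hP, h⟩ := he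
  obtain ⟨Q, _, _, s', r', hQ, h'⟩ := hf
  exact ⟨P × Q, _, _, s.prod s', r.coprod r', inferInstance, fun x => by simp [h, h', add_smul]⟩

open TensorProduct in
lemma factorsThroughProjective_of_local {e : S} (he : e * e = e) [Module.Flat S F]
    (hC : ProductChainCondition S) [IsLocalRing (S ⧸ Ideal.span {1 - e})] :
    FactorsThroughProjective S F e := by
  set T := S ⧸ Ideal.span {1 - e} with hT
  have hCT : ProductChainCondition T := hC.of_surjective _ Ideal.Quotient.mk_surjective
  have hpT : Module.Projective T (T ⊗[S] F) := hCT.projective_of_isLocalRing _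
  let τ : T →ₗ[S] S := Submodule.liftQ (Ideal.span {1 - e}) (LinearMap.lsmul S S e) <| by
    rw [Ideal.span, Submodule.span_le, Set.singleton_subset_iff]
    simp [mul_sub, he]
  have hτ : ∀ s : S, τ (Submodule.Quotient.mk s) = e * s := fun s => rfl
  have hST : Module.Projective S T := by
    refine Module.Projective.of_split τ (Submodule.mkQ (Ideal.span {1 - e})) ?_
    ext
    refine (Ideal.Quotient.eq (I := Ideal.span {1 - e})).2 ?_
    refine Ideal.mem_span_singleton.2 ⟨-1, ?_⟩
    change e * 1 - 1 = _
    ring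
  obtain ⟨σ, hσ⟩ := hpT.out
  have hp : Module.Projective S (T ⊗[S] F) := by
    classical
    have : Module.Projective S ((T ⊗[S] F) →₀ T) :=
      .of_equiv (finsuppLequivDFinsupp (ι := T ⊗[S] F) (M := T) S).symm
    refine Module.Projective.of_split (σ.restrictScalars S)
      ((Finsupp.linearCombination T id).restrictScalars S) ?_
    exact LinearMap.ext fun x => hσ x
  refine ⟨T ⊗[S] F, inferInstance, inferInstance, TensorProduct.mk S T F 1,
    TensorProduct.lid S F ∘ₗ LinearMap.rTensor F τ, hp, fun x => ?_⟩
  have : τ 1 = e := by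
    rw [show (1 : T) = Submodule.Quotient.mk 1 from rfl, hτ, mul_one]
  simp [this]

lemma isLocalRing [Nontrivial S] (hC : ProductChainCondition S)
    (h : ∀ e : S, e * e = e → e = 0 ∨ e = 1) : IsLocalRing S := by
  refine IsLocalRing.of_isUnit_or_isUnit_one_sub_self fun a => ?_
  obtain ⟨n, r, hr⟩ := hC fun _ => a
  simp only [Finset.prod_const, Finset.card_range] at hr
  have h1 : ∀ k, a ^ n * (a * r) ^ k = a ^ n := by
    intro k
    induction k with
    | zero => simp
    | succ k ih => rw [pow_succ, ← mul_assoc, ih, ← mul_assoc, ← pow_succ, ← hr]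
  rcases h ((a * r) ^ n) (by linear_combination r ^ n * h1 n) with h0 | h0
  · right
    have := h1 n
    rw [h0, mul_zero] at this
    exact IsNilpotent.isUnit_one_sub ⟨n, this.symm⟩
  · left
    rcases Nat.eq_zero_or_pos n with rfl | hn
    · exact IsUnit.of_mul_eq_one r (by simpa using hr.symm)
    · exact isUnit_of_mul_isUnit_left ((isUnit_pow_iff hn.ne').1 (h0 ▸ isUnit_one))

theorem isPerfectRing (hC : ProductChainCondition S) : IsPerfectRing S := by
  intro F _ _ hF
  suffices FactorsThroughProjective S F 1 by
    obtain ⟨P, _, _, s, r, hP, h⟩ := this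
    exact Module.Projective.of_split s r (LinearMap.ext fun x => by simp [h])
  by_contra hbad
  let B := {e : S // e * e = e ∧ ¬ FactorsThroughProjective S F e}
  have step : ∀ e : B, ∃ e' : B, e'.1 ≠ e.1 ∧ e.1 * e'.1 = e'.1 := by
    rintro ⟨e, he, hbad⟩
    have he0 : e ≠ 0 := by
      rintro rfl
      exact hbad ⟨PUnit, inferInstance, inferInstance, 0, 0, inferInstance, by simp⟩
    by_contra! hcon
    have hnt : Nontrivial (S ⧸ Ideal.span {1 - e}) := by
      refine Ideal.Quotient.nontrivial_iff.2 fun htop => he0 ?_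
      obtain ⟨c, hc⟩ := Ideal.mem_span_singleton.1 ((Ideal.eq_top_iff_one _).1 htop)
      calc e = e * 1 := (mul_one e).symm
        _ = (e - e * e) * c := by rw [hc]; ring
        _ = 0 := by rw [he, sub_self, zero_mul]
    have hloc : IsLocalRing (S ⧸ Ideal.span {1 - e}) := by
      refine isLocalRing (hC.of_surjective _ Ideal.Quotient.mk_surjective) fun f hf => ?_
      obtain ⟨f, rfl⟩ := Ideal.Quotient.mk_surjective f
      rw [← map_mul, Ideal.Quotient.eq, Ideal.mem_span_singleton] at hf
      obtain ⟨c, hc⟩ := hf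
      have hef : (e * f) * (e * f) = e * f := by
        linear_combination (f * f - f * f * 0) * he + e * hc - c * he
      have hmk : Ideal.Quotient.mk (Ideal.span {1 - e}) e = 1 := by
        rw [← map_one (Ideal.Quotient.mk _), eq_comm, Ideal.Quotient.eq]
        exact Ideal.mem_span_singleton_self _
      by_cases h1 : FactorsThroughProjective S F (e * f)
      · by_cases h2 : FactorsThroughProjective S F (e - e * f)
        · exact absurd (by simpa using h1.add h2) hbad
        · have : e - e * f = e := by
            by_contra hne
            exact hcon ⟨e - e * f, by linear_combination (1 - 2 * f) * he + hef, h2⟩ hne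
              (by change e * (e - e * f) = e - e * f; linear_combination (1 - f) * he)
          left
          have := congrArg (Ideal.Quotient.mk (Ideal.span {1 - e})) (sub_eq_self.1 this)
          rwa [map_mul, hmk, one_mul, map_zero] at this
      · have : e * f = e := by
          by_contra hne
          exact hcon ⟨e * f, hef, h1⟩ hne
            (by change e * (e * f) = e * f; linear_combination f * he)
        right
        have := congrArg (Ideal.Quotient.mk (Ideal.span {1 - e})) this
        rwa [map_mul, hmk, one_mul] at this
    exact hbad (factorsThroughProjective_of_local he hC)
  choose nxt hne hle using step
  let q : ℕ → B := fun n => Nat.rec ⟨1, by simp, hbad⟩ (fun _ e => nxt e) n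
  have hq : ∀ n, ∏ k ∈ Finset.range (n + 1), (q k).1 = (q n).1 := by
    intro n
    induction n with
    | zero => simp
    | succ n ih => rw [Finset.prod_range_succ, ih]; exact hle (q n)
  obtain ⟨n, r, hr⟩ := hC fun k => (q (k + 1)).1
  have hq' : ∀ n, ∏ k ∈ Finset.range n, (q (k + 1)).1 = (q n).1 := by
    intro n
    rw [← hq n, Finset.prod_range_succ', show (q 0).1 = 1 from rfl, mul_one]
  rw [hq', hq'] at hr
  refine hne (q n) ?_
  have h1 : (q n).1 * (q (n + 1)).1 = (q (n + 1)).1 := hle (q n)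
  have h2 := (q (n + 1)).2.1
  change (q (n + 1)).1 = (q n).1
  linear_combination r * h2 + (q (n + 1)).1 * hr - hr - h1

end ProductChainCondition

namespace GabrielTopology

variable {R : Type u} [CommRing R] {G : GabrielTopology R}

lemma FinitelyGenerated.exists_isPrime_of_notMem (hG : G.FinitelyGenerated) {I : Ideal R}
    (hI : I ∉ G.sets) : ∃ q : Ideal R, q.IsPrime ∧ q ∉ G.sets ∧ I ≤ q := by
  obtain ⟨q, hIq, hq⟩ := zorn_le_nonempty₀ {q : Ideal R | q ∉ G.sets} (by
    intro c hc hchain y hy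
    refine ⟨sSup c, fun hmem => ?_, fun z hz => le_sSup hz⟩
    obtain ⟨J, hJ, hle, hfg⟩ := hG _ hmem
    obtain ⟨q, hq, hJq⟩ :=
      (CompleteLattice.isCompactElement_iff_le_of_directed_sSup_le (Ideal R) J).1
        ((Submodule.fg_iff_compact J).1 hfg) c ⟨y, hy⟩ hchain.directedOn hle
    exact hc hq (G.mem_of_le hJ hJq)) I hI
  refine ⟨q, ⟨fun h => hq.prop (h ▸ G.top_mem), ?_⟩, hq.prop, hIq⟩
  intro a b hab
  by_contra! hcon
  have key : ∀ c ∉ q, q ⊔ Ideal.span {c} ∈ G.sets := by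
    intro c hc
    by_contra hmem
    exact hc (hq.le_of_ge hmem le_sup_left
      ((le_sup_right : _ ≤ q ⊔ Ideal.span {c}) (Ideal.mem_span_singleton_self c)))
  refine hq.prop (G.gabriel q _ (key a hcon.1) fun r hr => G.mem_of_le (key b hcon.2) ?_)
  intro s hs
  obtain ⟨q₁, hq₁, a₁, ha₁, rfl⟩ := Submodule.mem_sup.1 hr
  obtain ⟨q₂, hq₂, b₁, hb₁, rfl⟩ := Submodule.mem_sup.1 hs
  obtain ⟨c, rfl⟩ := Ideal.mem_span_singleton.1 ha₁
  obtain ⟨d, rfl⟩ := Ideal.mem_span_singleton.1 hb₁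
  rw [Submodule.mem_colon]
  intro t ht
  obtain ⟨e, rfl⟩ := Ideal.mem_span_singleton.1 ht
  rw [smul_eq_mul, show (q₂ + b * d) * ((q₁ + a * c) * e) =
    q₂ * ((q₁ + a * c) * e) + q₁ * (b * d * e) + a * b * (d * c * e) by ring]
  exact q.add_mem (q.add_mem (q.mul_mem_right _ hq₂) (q.mul_mem_right _ hq₁))
    (q.mul_mem_right _ hab)

variable (G) in
/-- The prime ideals outside a Gabriel topology. -/
abbrev ClosedPrime : Type u := {q : PrimeSpectrum R // q.asIdeal ∉ G.sets}

variable (G) in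
/-- The product of the local rings at the primes outside a Gabriel topology. -/
abbrev LocalProduct : Type u := ∀ q : G.ClosedPrime, Localization.AtPrime q.1.asIdeal

lemma FinitelyGenerated.mem_of_forall (hG : G.FinitelyGenerated) {I : Ideal R}
    (h : ∀ q : G.ClosedPrime, ¬ I ≤ q.1.asIdeal) : I ∈ G.sets := by
  by_contra hI
  obtain ⟨q, hq, hqG, hle⟩ := hG.exists_isPrime_of_notMem hI
  exact h ⟨⟨q, hq⟩, hqG⟩ hle

lemma ClosedPrime.exists_notMem (q : G.ClosedPrime) {J : Ideal R} (hJ : J ∈ G.sets) :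
    ∃ j ∈ J, j ∉ q.1.asIdeal := by
  by_contra! h
  exact q.2 (G.mem_of_le hJ h)

/-- An ideal of `G` generates the unit ideal of `LocalProduct G`. -/
lemma FinitelyGenerated.exists_sum_smul_eq_one (hG : G.FinitelyGenerated) {J : Ideal R}
    (hJ : J ∈ G.sets) : ∃ (t : Finset R) (x : R → G.LocalProduct), (∀ j ∈ t, j ∈ J) ∧
      ∑ j ∈ t, j • x j = 1 := by
  classical
  obtain ⟨J', hJ', hle, t, rfl⟩ := hG J hJ
  have h : ∀ q : G.ClosedPrime, ∃ j ∈ t, j ∉ q.1.asIdeal := by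
    intro q
    by_contra! h
    exact q.2 (G.mem_of_le hJ' (Ideal.span_le.2 h))
  choose j hjt hj using h
  refine ⟨t, fun r q => if h : r = j q then IsLocalization.mk' _ 1
    (⟨r, by rw [h]; exact hj q⟩ : q.1.asIdeal.primeCompl) else 0,
    fun r hr => hle (Ideal.subset_span hr), funext fun q => ?_⟩
  rw [Finset.sum_apply, Finset.sum_eq_single (j q)]
  · simp only [Pi.smul_apply, dif_pos, Algebra.smul_def]
    exact IsLocalization.mk'_spec' (Localization.AtPrime q.1.asIdeal) (1 : R)
      (⟨j q, hj q⟩ : q.1.asIdeal.primeCompl) |>.trans (map_one _)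
  · intro r _ hr
    simp [hr]
  · exact fun h => (h (hjt q)).elim

lemma FinitelyGenerated.isDivisible_localProduct (hG : G.FinitelyGenerated) :
    G.IsDivisible G.LocalProduct := by
  intro J hJ
  obtain ⟨t, x, ht, hx⟩ := hG.exists_sum_smul_eq_one hJ
  rw [eq_top_iff]
  intro s _
  rw [← one_mul s, ← hx, Finset.sum_mul]
  refine Submodule.sum_mem _ fun j hj => ?_
  rw [smul_mul_assoc]
  exact Submodule.smul_mem_smul (ht j hj) trivial

variable (G) in
/-- Every descending sequence of products is stationary up to `G`-torsion. -/
def TorsionProductChainCondition : Prop :=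
  ∀ a : ℕ → R, ∃ n, ∃ J ∈ G.sets, ∀ j ∈ J, ∃ r,
    (∏ k ∈ Finset.range n, a k) * j = (∏ k ∈ Finset.range (n + 1), a k) * r

/-- The colon ideal `(b : a)`. -/
lemma exists_colon_ideal (a b : R) : ∃ I : Ideal R, ∀ x, x ∈ I ↔ ∃ r, a * x = b * r :=
  ⟨Submodule.comap (LinearMap.lsmul R R a) (Ideal.span {b}), fun x => by
    simp [Ideal.mem_span_singleton, Dvd.dvd]⟩

lemma MemA.self : G.MemA R := MemA.of_projective

theorem AClosedUnderDirectLimits.torsionProductChainCondition (hG : G.FinitelyGenerated)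
    (hcl : G.AClosedUnderDirectLimits) : G.TorsionProductChainCondition := by
  intro a
  obtain ⟨n, w, hw⟩ := hcl.exists_prod_smul_eq MemA.self hG.isDivisible_localProduct a
    (LinearMap.toSpanSingleton R G.LocalProduct 1) (1 : R)
  obtain ⟨I, hI⟩ := exists_colon_ideal (∏ k ∈ Finset.range n, a k)
    (∏ k ∈ Finset.range (n + 1), a k)
  refine ⟨n, I, hG.mem_of_forall fun q hle => ?_, fun j hj => (hI j).1 hj⟩
  have hq := congrFun hw q
  obtain ⟨⟨r, s⟩, hrs⟩ := IsLocalization.surj q.1.asIdeal.primeCompl (w 1 q)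
  have : algebraMap R (Localization.AtPrime q.1.asIdeal)
      ((∏ k ∈ Finset.range n, a k) * s) = algebraMap R _
      ((∏ k ∈ Finset.range (n + 1), a k) * r) := by
    rw [LinearMap.toSpanSingleton_apply, one_smul, Pi.smul_apply, Pi.smul_apply, Pi.one_apply,
      Algebra.smul_def, Algebra.smul_def, mul_one] at hq
    rw [map_mul, map_mul, ← hrs, hq]
    exact mul_assoc _ _ _
  obtain ⟨c, hc⟩ := (IsLocalization.eq_iff_exists q.1.asIdeal.primeCompl _).1 this
  refine (q.1.asIdeal.primeCompl.mul_mem s.2 c.2 : _) (hle ((hI _).2 ⟨r * c, ?_⟩))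
  linear_combination hc

end GabrielTopology

namespace GabrielTopology

variable {R : Type u} [CommRing R] {G : GabrielTopology R}

namespace TorsionProductChainCondition

lemma exists_notMem (h : G.TorsionProductChainCondition) (a : ℕ → R) : ∃ n,
    ∀ q : G.ClosedPrime, ∃ c ∉ q.1.asIdeal, ∃ r,
      (∏ k ∈ Finset.range n, a k) * c = (∏ k ∈ Finset.range (n + 1), a k) * r := by
  obtain ⟨n, J, hJ, hn⟩ := h a
  refine ⟨n, fun q => ?_⟩
  obtain ⟨c, hcJ, hc⟩ := q.exists_notMem hJ
  exact ⟨c, hc, hn c hcJ⟩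

lemma eq_of_le (h : G.TorsionProductChainCondition) {q q' : G.ClosedPrime}
    (hle : q.1.asIdeal ≤ q'.1.asIdeal) : q = q' := by
  refine Subtype.ext (PrimeSpectrum.ext (le_antisymm hle fun a ha => ?_))
  obtain ⟨n, hn⟩ := h.exists_notMem fun _ => a
  obtain ⟨c, hc, r, hr⟩ := hn q'
  simp only [Finset.prod_const, Finset.card_range] at hr
  have h0 : a ^ n * (c - a * r) ∈ q.1.asIdeal := by
    rw [show a ^ n * (c - a * r) = 0 by linear_combination hr]
    exact zero_mem _
  rcases q.1.isPrime.mem_or_mem h0 with h1 | h1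
  · exact q.1.isPrime.mem_of_pow_mem n h1
  · exact (hc ((q'.1.asIdeal.sub_mem_iff_left (Ideal.mul_mem_right _ _ ha)).1 (hle h1))).elim

lemma exists_isolating (h : G.TorsionProductChainCondition) (q : G.ClosedPrime) :
    ∃ a ∉ q.1.asIdeal, ∀ q' : G.ClosedPrime, q' ≠ q → a ∈ q'.1.asIdeal := by
  by_contra! hcon
  have step : ∀ c : q.1.asIdeal.primeCompl, ∃ b : q.1.asIdeal.primeCompl, ∃ q' : G.ClosedPrime,
      (c : R) ∉ q'.1.asIdeal ∧ (b : R) ∈ q'.1.asIdeal := by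
    rintro ⟨c, hc⟩
    obtain ⟨q', hne, hq'⟩ := hcon c hc
    have : ¬ q'.1.asIdeal ≤ q.1.asIdeal := fun hle => hne (h.eq_of_le hle)
    obtain ⟨b, hb, hbq⟩ := SetLike.not_le_iff_exists.1 this
    exact ⟨⟨b, hbq⟩, q', hq', hb⟩
  choose β κ hκ hβ using step
  let c : ℕ → q.1.asIdeal.primeCompl := fun n => Nat.rec 1 (fun _ c => c * β c) n
  have hc : ∀ n, (c n).1 = ∏ k ∈ Finset.range n, (β (c k) : R) := by
    intro n
    induction n with
    | zero => rfl
    | succ n ih => rw [Finset.prod_range_succ, ← ih]; rfl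
  obtain ⟨n, hn⟩ := h.exists_notMem fun k => (β (c k) : R)
  obtain ⟨d, hd, r, hr⟩ := hn (κ (c n))
  rw [Finset.prod_range_succ, ← hc] at hr
  have : (c n).1 * d ∈ (κ (c n)).1.asIdeal := by
    rw [hr]
    exact Ideal.mul_mem_right _ _ (Ideal.mul_mem_left _ _ (hβ _))
  exact ((κ (c n)).1.isPrime.mem_or_mem this).elim (hκ _) hd

lemma finite (hG : G.FinitelyGenerated) (h : G.TorsionProductChainCondition) :
    Finite G.ClosedPrime := by
  choose a ha ha' using h.exists_isolating
  have hmem : ⨆ q, Ideal.span {a q} ∈ G.sets := by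
    refine hG.mem_of_forall fun q hle => ha q (hle ?_)
    exact le_iSup (fun q => Ideal.span {a q}) q (Ideal.mem_span_singleton_self _)
  obtain ⟨J, hJ, hle, hfg⟩ := hG _ hmem
  obtain ⟨t, ht⟩ := CompleteLattice.IsCompactElement.exists_finset_of_le_iSup (Ideal R)
    ((Submodule.fg_iff_compact J).1 hfg) _ hle
  refine Finite.of_finite_univ (t.finite_toSet.subset fun q _ => ?_)
  by_contra hq
  refine q.2 (G.mem_of_le hJ (ht.trans (iSup₂_le fun q' hq' => ?_)))
  rw [Ideal.span_singleton_le_iff_mem]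
  exact ha' q' q fun he => hq (he ▸ hq')

end TorsionProductChainCondition

variable (G) in
/-- Every ideal of the Gabriel topology contains a principal ideal of the topology. -/
def HasPrincipalBasis : Prop := ∀ J ∈ G.sets, ∃ s ∈ J, Ideal.span {s} ∈ G.sets

theorem TorsionProductChainCondition.hasPrincipalBasis (hG : G.FinitelyGenerated)
    (h : G.TorsionProductChainCondition) : G.HasPrincipalBasis := by
  intro J hJ
  rcases isEmpty_or_nonempty G.ClosedPrime with he | ⟨⟨q₀⟩⟩
  · exact ⟨0, J.zero_mem, hG.mem_of_forall fun q => he.elim q⟩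
  · have hfin := h.finite hG
    have h1 : ¬ ((J : Set R) ⊆ ⋃ q ∈ (Set.univ : Set G.ClosedPrime), (q.1.asIdeal : Set R)) := by
      rw [Ideal.subset_union_prime_finite Set.finite_univ q₀ q₀ fun q _ _ _ => q.1.isPrime]
      rintro ⟨q, -, hq⟩
      exact q.2 (G.mem_of_le hJ hq)
    obtain ⟨s, hs, hsq⟩ := Set.not_subset.1 h1
    refine ⟨s, hs, hG.mem_of_forall fun q hq => hsq ?_⟩
    exact Set.mem_biUnion (Set.mem_univ q) (hq (Ideal.mem_span_singleton_self s))

variable (G) in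
/-- The elements generating an ideal of a Gabriel topology. -/
def denominators : Submonoid R where
  carrier := {s | Ideal.span {s} ∈ G.sets}
  one_mem' := by simpa using G.top_mem
  mul_mem' {a b} ha hb := by
    refine G.gabriel _ _ ha fun r hr => G.mem_of_le hb fun x hx => ?_
    obtain ⟨c, rfl⟩ := Ideal.mem_span_singleton.1 hr
    obtain ⟨d, rfl⟩ := Ideal.mem_span_singleton.1 hx
    rw [Submodule.mem_colon]
    intro t ht
    obtain ⟨e, rfl⟩ := Ideal.mem_span_singleton.1 ht
    exact Ideal.mem_span_singleton.2 ⟨d * c * e, by simp only [smul_eq_mul]; ring⟩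

lemma Faithful.eq_zero_of_mul (hG : G.Faithful) {s : R} (hs : s ∈ G.denominators) {r : R}
    (h : s * r = 0) : r = 0 :=
  hG r (G.mem_of_le hs (by
    rw [Ideal.span_singleton_le_iff_mem, Ideal.mem_torsionOf_iff]; exact h))

lemma IsDivisible.exists_smul_eq {D : Type u} [AddCommGroup D] [Module R D]
    (hD : G.IsDivisible D) {s : R} (hs : s ∈ G.denominators) (x : D) : ∃ y, s • y = x := by
  have : x ∈ Ideal.span {s} • (⊤ : Submodule R D) := by rw [hD _ hs]; trivial
  rw [Submodule.ideal_span_singleton_smul, Submodule.mem_smul_pointwise_iff_exists] at this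
  obtain ⟨y, -, hy⟩ := this
  exact ⟨y, hy⟩

lemma HasPrincipalBasis.isDivisible (hP : G.HasPrincipalBasis) {D : Type u} [AddCommGroup D]
    [Module R D] (h : ∀ s ∈ G.denominators, ∀ x : D, ∃ y, s • y = x) : G.IsDivisible D := by
  intro J hJ
  obtain ⟨s, hsJ, hs⟩ := hP J hJ
  rw [eq_top_iff]
  intro x _
  obtain ⟨y, rfl⟩ := h s hs x
  exact Submodule.smul_mem_smul hsJ trivial

end GabrielTopology

namespace GabrielTopology

variable {R : Type u} [CommRing R] {G : GabrielTopology R}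

lemma mul_mem {I J : Ideal R} (hI : I ∈ G.sets) (hJ : J ∈ G.sets) : I * J ∈ G.sets := by
  refine G.gabriel _ I hI fun r hr => G.mem_of_le hJ fun x hx => ?_
  rw [Submodule.mem_colon]
  intro t ht
  obtain ⟨e, rfl⟩ := Ideal.mem_span_singleton.1 ht
  rw [smul_eq_mul, mul_comm x]
  exact Ideal.mul_mem_mul (I.mul_mem_right e hr) hx

section RingOfQuotients

/-- The ideal of the elements of `R` that multiply `x` into the image of `R`. -/
def conductor {S : Type u} [CommRing S] [Algebra R S] (x : S) : Ideal R :=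
  Submodule.comap (LinearMap.toSpanSingleton R S x) (LinearMap.range (Algebra.linearMap R S))

lemma mem_conductor {S : Type u} [CommRing S] [Algebra R S] {x : S} {j : R} :
    j ∈ conductor x ↔ ∃ r, algebraMap R S r = j • x := by
  simp [conductor]

variable (G) in
/-- The ring of quotients, as a subalgebra of `LocalProduct G`. -/
def quotientSubalgebra : Subalgebra R G.LocalProduct where
  carrier := {x | conductor x ∈ G.sets}
  mul_mem' {x y} hx hy := G.mem_of_le (mul_mem hx hy) (Submodule.mul_le.2 fun i hi j hj => by
    obtain ⟨r, hr⟩ := mem_conductor.1 hi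
    obtain ⟨s, hs⟩ := mem_conductor.1 hj
    exact mem_conductor.2 ⟨r * s, by rw [map_mul, hr, hs, smul_mul_smul_comm]⟩)
  add_mem' {x y} hx hy := G.mem_of_le (G.inf_mem hx hy) fun j hj => by
    obtain ⟨r, hr⟩ := mem_conductor.1 hj.1
    obtain ⟨s, hs⟩ := mem_conductor.1 hj.2
    exact mem_conductor.2 ⟨r + s, by rw [map_add, hr, hs, smul_add]⟩
  algebraMap_mem' r := G.mem_of_le G.top_mem fun j _ =>
    mem_conductor.2 ⟨j * r, by rw [map_mul, Algebra.smul_def]⟩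

lemma eq_zero_of_torsionOf_mem (x : G.LocalProduct)
    (hx : Ideal.torsionOf R G.LocalProduct x ∈ G.sets) : x = 0 := by
  funext q
  obtain ⟨j, hj, hjq⟩ := q.exists_notMem hx
  have h := congrFun ((Ideal.mem_torsionOf_iff _ _).1 hj) q
  rw [Pi.smul_apply, Algebra.smul_def] at h
  exact (IsUnit.mul_right_eq_zero
    (IsLocalization.map_units (Localization.AtPrime q.1.asIdeal)
      (⟨j, hjq⟩ : q.1.asIdeal.primeCompl))).1 h

lemma FinitelyGenerated.isRingOfQuotients (hG : G.FinitelyGenerated) :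
    G.IsRingOfQuotients G.quotientSubalgebra where
  torsionFree x hx := by
    refine Subtype.ext (eq_zero_of_torsionOf_mem x.1 (G.mem_of_le hx fun j hj => ?_))
    rw [Ideal.mem_torsionOf_iff] at hj ⊢
    exact congrArg Subtype.val hj
  gInjective J hJ f := by
    obtain ⟨t, x, ht, hx⟩ := hG.exists_sum_smul_eq_one hJ
    set s : G.LocalProduct := ∑ i ∈ t.attach, x i * (f ⟨i, ht i i.2⟩ : G.LocalProduct)
    have hs : ∀ j : J, (f j : G.LocalProduct) = (j : R) • s := by
      intro j
      have h1 : ∀ i ∈ t.attach, (j : R) • (x i * (f ⟨i, ht i i.2⟩ : G.LocalProduct)) =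
          ((i : R) • x i) * (f j : G.LocalProduct) := by
        intro i _
        have : (j : R) • f ⟨i, ht i i.2⟩ = (i : R) • f j := by
          rw [← map_smul, ← map_smul]
          congr 1
          exact Subtype.ext (mul_comm _ _)
        rw [← mul_smul_comm, smul_mul_assoc, ← mul_smul_comm]
        exact congrArg (x i * ·) (congrArg Subtype.val this)
      rw [Finset.smul_sum, Finset.sum_congr rfl h1, ← Finset.sum_mul,
        Finset.sum_attach t fun i => i • x i, hx, one_mul]
    refine ⟨⟨s, G.gabriel _ J hJ fun r hr => G.mem_of_le (f ⟨r, hr⟩).2 fun y hy => ?_⟩,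
      fun j => Subtype.ext (hs j)⟩
    obtain ⟨u, hu⟩ := mem_conductor.1 hy
    rw [hs] at hu
    rw [Submodule.mem_colon]
    intro z hz
    obtain ⟨e, rfl⟩ := Ideal.mem_span_singleton.1 hz
    refine mem_conductor.2 ⟨e * u, ?_⟩
    rw [map_mul, hu, ← Algebra.smul_def, smul_smul, smul_smul]
    congr 1
    rw [smul_eq_mul]
    ring
  ker_torsion r hr := by
    refine hG.mem_of_forall fun q hle => ?_
    have h : algebraMap R (Localization.AtPrime q.1.asIdeal) r = 0 :=
      congrFun (congrArg Subtype.val hr) q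
    obtain ⟨c, hc⟩ := (IsLocalization.map_eq_zero_iff q.1.asIdeal.primeCompl _ _).1 h
    exact c.2 (hle ((Ideal.mem_torsionOf_iff _ _).2 hc))
  coker_torsion x := ⟨_, x.2, fun j hj => by
    obtain ⟨r, hr⟩ := mem_conductor.1 hj
    exact ⟨r, Subtype.ext hr.symm⟩⟩

end RingOfQuotients

namespace IsRingOfQuotients

variable {Q : Type u} [CommRing Q] [Algebra R Q]

lemma injective (hQ : G.IsRingOfQuotients Q) (hG : G.Faithful) :
    Function.Injective (algebraMap R Q) :=
  (injective_iff_map_eq_zero _).2 fun r hr => hG r (hQ.ker_torsion r hr)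

theorem torsionProductChainCondition (hQ : G.IsRingOfQuotients Q) (hG : G.Faithful)
    (hp : IsPerfectRing Q) : G.TorsionProductChainCondition := by
  intro a
  obtain ⟨n, u, hu⟩ := hp.exists_prod_eq fun k => algebraMap R Q (a k)
  obtain ⟨J, hJ, h⟩ := hQ.coker_torsion u
  refine ⟨n, J, hJ, fun j hj => ?_⟩
  obtain ⟨r, hr⟩ := h j hj
  refine ⟨r, hQ.injective hG ?_⟩
  rw [← map_prod, ← map_prod] at hu
  rw [map_mul, map_mul, hu, ← hr, Algebra.smul_def]
  ring

lemma isLocalization (hQ : G.IsRingOfQuotients Q) (hG : G.Faithful) (hP : G.HasPrincipalBasis) :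
    IsLocalization G.denominators Q where
  map_units := by
    rintro ⟨s, hs⟩
    obtain ⟨f, hf⟩ := LinearMap.exists_comp_eq_of_surjective
      (LinearMap.codRestrict (Ideal.span {s}) (LinearMap.toSpanSingleton R R s)
        fun c => Ideal.mul_mem_left _ _ (Ideal.mem_span_singleton_self s))
      (fun ⟨x, hx⟩ => by
        obtain ⟨c, rfl⟩ := Ideal.mem_span_singleton.1 hx
        exact ⟨c, Subtype.ext (mul_comm _ _)⟩)
      (Algebra.linearMap R Q) (fun x hx => by
        have : x * s = 0 := congrArg Subtype.val hx
        rw [hG.eq_zero_of_mul hs ((mul_comm s x).trans this), map_zero])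
    obtain ⟨q, hq⟩ := hQ.gInjective _ hs f
    refine IsUnit.of_mul_eq_one q ?_
    have h1 := hf 1
    rw [hq, Algebra.linearMap_apply, map_one (algebraMap R Q)] at h1
    have h2 : ((1 : R) * s) • q = 1 := h1
    rwa [one_mul, Algebra.smul_def] at h2
  surj q := by
    obtain ⟨J, hJ, h⟩ := hQ.coker_torsion q
    obtain ⟨s, hsJ, hs⟩ := hP J hJ
    obtain ⟨r, hr⟩ := h s hsJ
    exact ⟨⟨r, ⟨s, hs⟩⟩, by rw [← hr, Algebra.smul_def, mul_comm]⟩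
  exists_of_eq h := ⟨1, by rw [hQ.injective hG h]⟩

theorem isPerfectLocalization (hQ : G.IsRingOfQuotients Q) (hG : G.Faithful)
    (hP : G.HasPrincipalBasis) : G.IsPerfectLocalization Q := by
  have hloc := hQ.isLocalization hG hP
  refine ⟨IsLocalization.flat Q G.denominators,
    fun S _ f g h => IsLocalization.ringHom_ext G.denominators h, fun J => ⟨fun hJ => ?_, ?_⟩⟩
  · obtain ⟨s, hsJ, hs⟩ := hP J hJ
    obtain ⟨v, hv⟩ := (IsLocalization.map_units Q (⟨s, hs⟩ : G.denominators)).exists_right_inv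
    rw [eq_top_iff]
    intro q _
    have : q = s • (v * q) := by
      rw [Algebra.smul_def, ← mul_assoc]
      exact (congrArg (· * q) hv).trans (one_mul q) |>.symm
    rw [this]
    exact Submodule.smul_mem_smul hsJ trivial
  · intro h
    rw [Ideal.smul_top_eq_map] at h
    have h1 : (1 : Q) ∈ J.map (algebraMap R Q) := by
      change (1 : Q) ∈ (J.map (algebraMap R Q)).restrictScalars R
      rw [h]
      trivial
    obtain ⟨⟨j, s⟩, hjs⟩ := (IsLocalization.mem_map_algebraMap_iff G.denominators Q).1 h1
    rw [one_mul] at hjs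
    refine G.mem_of_le s.2 ?_
    rw [Ideal.span_singleton_le_iff_mem, hQ.injective hG hjs]
    exact j.2

end IsRingOfQuotients

end GabrielTopology

section

variable {R : Type u} [CommRing R]

/-- All linear relations between `s`-torsion elements are trivial modulo `s`; that is, the
`s`-torsion submodule of `N` is flat over `R / s`. -/
def TrivialTorsionRelations (s : R) (N : Type u) [AddCommGroup N] [Module R N] : Prop :=
  ∀ (n : ℕ) (r : Fin n → R) (x : Fin n → N), (∀ i, s • x i = 0) → ∑ i, r i • x i = 0 →
    ∃ (m : ℕ) (y : Fin m → N) (a : Fin n → Fin m → R), (∀ j, s • y j = 0) ∧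
      (∀ i, x i = ∑ j, a i j • y j) ∧ ∀ j, s ∣ ∑ i, r i * a i j

lemma TrivialTorsionRelations.of_linearEquiv {s : R} {M N : Type u} [AddCommGroup M] [Module R M]
    [AddCommGroup N] [Module R N] (h : TrivialTorsionRelations s M) (e : M ≃ₗ[R] N) :
    TrivialTorsionRelations s N := by
  intro n r x hx hrx
  obtain ⟨m, y, a, hy, hxy, ha⟩ := h n r (fun i => e.symm (x i))
    (fun i => by rw [← map_smul, hx, map_zero])
    (by simp only [← map_smul]; rw [← map_sum, hrx, map_zero])
  refine ⟨m, fun j => e (y j), a, fun j => by rw [← map_smul, hy, map_zero], fun i => ?_, ha⟩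
  have := congrArg e (hxy i)
  simpa using this

lemma Submodule.exists_mem_forall_mem_of_sSup {F : Type u} [AddCommGroup F] [Module R F]
    {c : Set (Submodule R F)} (hne : c.Nonempty) (hc : DirectedOn (· ≤ ·) c) {κ : Type*} [Finite κ]
    (z : κ → F) (hz : ∀ k, z k ∈ sSup c) : ∃ P ∈ c, ∀ k, z k ∈ P := by
  simp only [Submodule.mem_sSup_of_directed hne hc] at hz
  choose P hP hzP using hz
  have : Nonempty c := hne.to_subtype
  obtain ⟨Q, hQ⟩ := hc.directed_val.finite_le fun k => (⟨P k, hP k⟩ : c)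
  exact ⟨Q.1, Q.2, fun k => hQ k (hzP k)⟩

lemma TrivialTorsionRelations.quotient_sSup {s : R} {F : Type u} [AddCommGroup F] [Module R F]
    {c : Set (Submodule R F)} (hne : c.Nonempty) (hc : DirectedOn (· ≤ ·) c)
    (h : ∀ P ∈ c, TrivialTorsionRelations s (F ⧸ P)) :
    TrivialTorsionRelations s (F ⧸ sSup c) := by
  intro n r x hx hrx
  choose z hz using fun i => Submodule.mkQ_surjective _ (x i)
  obtain rfl : (fun i => (sSup c).mkQ (z i)) = x := funext hz
  simp only [← map_smul] at hx hrx
  rw [← map_sum] at hrx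
  have hmem : ∀ k : Option (Fin n), k.elim (∑ i, r i • z i) (fun i => s • z i) ∈ sSup c := by
    rintro (_ | i)
    · exact (Submodule.Quotient.mk_eq_zero _).1 hrx
    · exact (Submodule.Quotient.mk_eq_zero _).1 (hx i)
  obtain ⟨P, hP, hzP⟩ := Submodule.exists_mem_forall_mem_of_sSup hne hc _ hmem
  obtain ⟨m, y, a, hy, hxy, ha⟩ := h P hP n r (fun i => P.mkQ (z i))
    (fun i => by rw [← map_smul]; exact (Submodule.Quotient.mk_eq_zero _).2 (hzP (some i)))
    (by
      simp only [← map_smul]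
      rw [← map_sum]
      exact (Submodule.Quotient.mk_eq_zero _).2 (hzP none))
  refine ⟨m, fun j => Submodule.factor (le_sSup hP) (y j), a, fun j => ?_, fun i => ?_, ha⟩
  · rw [← map_smul, hy, map_zero]
  · have := congrArg (Submodule.factor (le_sSup hP)) (hxy i)
    simpa using this

namespace GabrielTopology

variable {G : GabrielTopology R}

lemma MemA.quotient_span_singleton {s : R} (hs : s ∈ G.denominators) :
    G.MemA (R ⧸ Ideal.span {s}) := by
  intro D _ _ hD
  refine Ext1Vanish.of_extend (X := R) (Y := Ideal.span {s}) .of_projective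
    (Ideal.span {s}).subtype (Submodule.mkQ (Ideal.span {s})) (Submodule.mkQ_surjective _)
    (LinearMap.exact_subtype_mkQ (Ideal.span {s})) fun f => ?_
  obtain ⟨y, hy⟩ := hD.exists_smul_eq hs (f ⟨s, Ideal.mem_span_singleton_self s⟩)
  refine ⟨LinearMap.toSpanSingleton R D y, ?_⟩
  rintro ⟨x, hx⟩
  obtain ⟨c, rfl⟩ := Ideal.mem_span_singleton.1 hx
  change (s * c) • y = _
  refine (mul_comm s c ▸ mul_smul c s y : (s * c) • y = c • s • y).trans ?_
  rw [hy, ← map_smul]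
  exact congrArg f (Subtype.ext (mul_comm c s))

lemma MemA.of_trivialTorsionRelations {s : R} (hs : s ∈ G.denominators)
    (hp : IsPerfectRing (R ⧸ Ideal.span {s})) {T : Type u} [AddCommGroup T] [Module R T]
    (h0 : ∀ x : T, s • x = 0) (h : TrivialTorsionRelations s T) : G.MemA T := by
  have hT : Module.IsTorsionBySet R T (Ideal.span {s}) :=
    (Module.isTorsionBySet_span_singleton_iff s).2 (fun x => h0 x)
  let _ := hT.module
  have hsmul : ∀ (r : R) (x : T), Ideal.Quotient.mk (Ideal.span {s}) r • x = r • x :=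
    fun r x => rfl
  have : IsScalarTower R (R ⧸ Ideal.span {s}) T := hT.isScalarTower
  have hflat : Module.Flat (R ⧸ Ideal.span {s}) T := by
    refine Module.Flat.of_forall_isTrivialRelation fun {n f x} hfx => ?_
    choose r hr using fun i => Ideal.Quotient.mk_surjective (f i)
    obtain rfl : (fun i => Ideal.Quotient.mk (Ideal.span {s}) (r i)) = f := funext hr
    obtain ⟨m, y, a, hy, hxy, ha⟩ := h n r x (fun i => h0 _) hfx
    refine ⟨m, fun i j => Ideal.Quotient.mk _ (a i j), y, hxy, fun j => ?_⟩
    simp only [← map_mul]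
    rw [← map_sum]
    exact Ideal.Quotient.eq_zero_iff_dvd _ _ |>.2 (ha j)
  have := hp T hflat
  obtain ⟨σ, hσ⟩ := this.out
  exact MemA.of_retract ((MemA.quotient_span_singleton hs).finsupp (ι := T))
    (σ.restrictScalars R)
    ((Finsupp.linearCombination (R ⧸ Ideal.span {s}) id).restrictScalars R) hσ

variable (G) in
/-- A divisible torsion module with trivial torsion relations. -/
structure IsTorsionFlat (N : Type u) [AddCommGroup N] [Module R N] : Prop where
  divisible : ∀ s ∈ G.denominators, ∀ x : N, ∃ y, s • y = x
  torsion : ∀ x : N, ∃ s ∈ G.denominators, s • x = 0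
  relations : ∀ s ∈ G.denominators, TrivialTorsionRelations s N

namespace IsTorsionFlat

lemma of_linearEquiv {M N : Type u} [AddCommGroup M] [Module R M] [AddCommGroup N] [Module R N]
    (h : G.IsTorsionFlat M) (e : M ≃ₗ[R] N) : G.IsTorsionFlat N where
  divisible s hs x := by
    obtain ⟨y, hy⟩ := h.divisible s hs (e.symm x)
    exact ⟨e y, by rw [← map_smul, hy, e.apply_symm_apply]⟩
  torsion x := by
    obtain ⟨s, hs, hsx⟩ := h.torsion (e.symm x)
    exact ⟨s, hs, e.symm.injective (by rw [map_smul, hsx, map_zero])⟩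
  relations s hs := (h.relations s hs).of_linearEquiv e

lemma quotient_sSup {F : Type u} [AddCommGroup F] [Module R F]
    {c : Set (Submodule R F)} (hne : c.Nonempty) (hc : DirectedOn (· ≤ ·) c)
    (h : ∀ P ∈ c, G.IsTorsionFlat (F ⧸ P)) : G.IsTorsionFlat (F ⧸ sSup c) := by
  obtain ⟨P, hP⟩ := id hne
  have hfac := Submodule.factor_surjective (le_sSup hP : P ≤ sSup c)
  refine ⟨fun s hs x => ?_, fun x => ?_, fun s hs => .quotient_sSup hne hc fun P hP =>
    (h P hP).relations s hs⟩
  · obtain ⟨x, rfl⟩ := hfac x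
    obtain ⟨y, rfl⟩ := (h P hP).divisible s hs x
    exact ⟨_, (map_smul _ s y).symm⟩
  · obtain ⟨x, rfl⟩ := hfac x
    obtain ⟨s, hs, hsx⟩ := (h P hP).torsion x
    exact ⟨s, hs, by rw [← map_smul, hsx, map_zero]⟩

lemma memA_torsionBy {N : Type u} [AddCommGroup N] [Module R N] (h : G.IsTorsionFlat N) {s : R}
    (hs : s ∈ G.denominators) (hp : IsPerfectRing (R ⧸ Ideal.span {s})) :
    G.MemA (Submodule.torsionBy R N s) := by
  refine MemA.of_trivialTorsionRelations hs hp (fun x => Subtype.ext x.2) ?_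
  intro n r x hx hrx
  obtain ⟨m, y, a, hy, hxy, ha⟩ := h.relations s hs n r (fun i => x i)
    (fun i => congrArg Subtype.val (hx i)) (by simpa using congrArg Subtype.val hrx)
  exact ⟨m, fun j => ⟨y j, hy j⟩, a, fun j => Subtype.ext (hy j),
    fun i => Subtype.ext (by simp [hxy]), ha⟩

/-- A linear map to a divisible module extends along `P ≤ {x | s • x ∈ P}`. -/
lemma exists_extend_one_step {F D : Type u} [AddCommGroup F] [Module R F] [AddCommGroup D]
    [Module R D] (hD : G.IsDivisible D) {P : Submodule R F} (h : G.IsTorsionFlat (F ⧸ P)) {s : R}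
    (hs : s ∈ G.denominators) (hp : IsPerfectRing (R ⧸ Ideal.span {s})) (f : P →ₗ[R] D) :
    ∃ (P' : Submodule R F) (hle : P ≤ P') (g : P' →ₗ[R] D), G.IsTorsionFlat (F ⧸ P') ∧
      (∀ x, s • x ∈ P → x ∈ P') ∧ ∀ x : P, g ⟨x, hle x.2⟩ = f x := by
  have hle : P ≤ P.comap (LinearMap.lsmul R F s) := fun x hx => P.smul_mem s hx
  obtain ⟨g, hg⟩ := (h.memA_torsionBy hs hp D hD).extend (Y := P)
    (X := P.comap (LinearMap.lsmul R F s)) (Submodule.inclusion hle)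
    (LinearMap.codRestrict (Submodule.torsionBy R (F ⧸ P) s)
      (P.mkQ ∘ₗ Submodule.subtype (P.comap (LinearMap.lsmul R F s))) (fun x =>
        (Submodule.Quotient.mk_eq_zero P).2 x.2))
    (Submodule.inclusion_injective hle) (by
      rintro ⟨x, hx⟩
      obtain ⟨x, rfl⟩ := P.mkQ_surjective x
      exact ⟨⟨x, (Submodule.Quotient.mk_eq_zero P).1 hx⟩, rfl⟩) (by
      rintro ⟨x, hx⟩
      constructor
      · intro h0
        exact ⟨⟨x, (Submodule.Quotient.mk_eq_zero P).1 (congrArg Subtype.val h0)⟩, rfl⟩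
      · rintro ⟨y, hy⟩
        refine Subtype.ext ((Submodule.Quotient.mk_eq_zero P).2 ?_)
        rw [← hy]
        exact y.2) f
  refine ⟨_, hle, g, ?_, fun x hx => hx, hg⟩
  have hker : P.comap (LinearMap.lsmul R F s) =
      LinearMap.ker (P.mkQ ∘ₗ LinearMap.lsmul R F s) := by
    rw [LinearMap.ker_comp, Submodule.ker_mkQ]
  refine h.of_linearEquiv ((Submodule.quotEquivOfEq _ _ hker).trans
    (LinearMap.quotKerEquivOfSurjective _ fun x => ?_)).symm
  obtain ⟨y, rfl⟩ := h.divisible s hs x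
  obtain ⟨y, rfl⟩ := P.mkQ_surjective y
  exact ⟨y, rfl⟩

theorem memA {N : Type u} [AddCommGroup N] [Module R N] (h : G.IsTorsionFlat N)
    (hp : ∀ s ∈ G.denominators, IsPerfectRing (R ⧸ Ideal.span {s})) : G.MemA N := by
  intro D _ _ hD
  have hsurj : Function.Surjective (Finsupp.linearCombination R (id : N → N)) :=
    Finsupp.linearCombination_id_surjective R N
  refine Ext1Vanish.of_extend (X := N →₀ R) (Y := LinearMap.ker (Finsupp.linearCombination R id))
    .of_projective (Submodule.subtype _) _ hsurj (LinearMap.exact_subtype_ker_map _) fun f => ?_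
  obtain ⟨g, hfg, hmax⟩ := zorn_le_nonempty₀
    {g : (N →₀ R) →ₗ.[R] D | G.IsTorsionFlat ((N →₀ R) ⧸ g.domain)} (by
      intro c hc hchain y hy
      refine ⟨LinearPMap.sSup c hchain.directedOn, ?_, fun z hz => LinearPMap.le_sSup _ hz⟩
      change G.IsTorsionFlat (_ ⧸ _)
      rw [LinearPMap.domain_sSup]
      refine .quotient_sSup (Set.Nonempty.image _ ⟨y, hy⟩)
        (hchain.directedOn.mono_comp LinearPMap.domain_mono.monotone) ?_
      rintro _ ⟨z, hz, rfl⟩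
      exact hc hz) ⟨_, f⟩ (h.of_linearEquiv (LinearMap.quotKerEquivOfSurjective _ hsurj).symm)
  have htop : g.domain = ⊤ := by
    refine eq_top_iff.2 fun x _ => ?_
    obtain ⟨s, hs, hsx⟩ := hmax.prop.torsion (g.domain.mkQ x)
    obtain ⟨P, hle, g', hP, hmem, hg'⟩ := exists_extend_one_step hD hmax.prop hs (hp s hs) g.toFun
    have : (⟨P, g'⟩ : (N →₀ R) →ₗ.[R] D) ≤ g := hmax.le_of_ge hP ⟨hle, fun x y hxy => by
      rw [← (Subtype.ext hxy : (⟨x, hle x.2⟩ : P) = y)]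
      exact (hg' x).symm⟩
    exact this.1 (hmem x ((Submodule.Quotient.mk_eq_zero g.domain).1 hsx))
  refine ⟨g.toFun ∘ₗ LinearMap.codRestrict g.domain LinearMap.id (fun x => htop ▸ trivial),
    fun y => ?_⟩
  exact (hfg.2 rfl).symm

end IsTorsionFlat

end GabrielTopology

end

section

variable {R : Type u} [CommRing R]

lemma IsModuleColimit.exists_eq_zero_of_finite {ι : Type u} [Preorder ι] [IsDirected ι (· ≤ ·)]
    {M : ι → Type u} [∀ i, AddCommGroup (M i)] [∀ i, Module R (M i)]
    {f : ∀ i j, i ≤ j → M i →ₗ[R] M j} [hf : DirectedSystem M fun i j h => f i j h]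
    {L : Type u} [AddCommGroup L] [Module R L] {g : ∀ i, M i →ₗ[R] L} (h : IsModuleColimit f g)
    {κ : Type*} [Finite κ] {i : ι} (x : κ → M i) (hx : ∀ k, g i (x k) = 0) :
    ∃ (j : ι) (hij : i ≤ j), ∀ k, f i j hij (x k) = 0 := by
  choose j hij hj using fun k => h.exists_eq_zero i (x k) (hx k)
  have : Nonempty ι := ⟨i⟩
  obtain ⟨l, hl⟩ := Finite.exists_le (fun k : Option κ => k.elim i j)
  refine ⟨l, hl none, fun k => ?_⟩
  rw [← hf.map_map (hij k) (hl (some k)), hj k, map_zero]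

lemma TrivialTorsionRelations.of_isModuleColimit {ι : Type u} [Preorder ι] [IsDirected ι (· ≤ ·)]
    [Nonempty ι] {M : ι → Type u} [∀ i, AddCommGroup (M i)] [∀ i, Module R (M i)]
    {f : ∀ i j, i ≤ j → M i →ₗ[R] M j} [DirectedSystem M fun i j h => f i j h]
    {L : Type u} [AddCommGroup L] [Module R L] {g : ∀ i, M i →ₗ[R] L} (h : IsModuleColimit f g)
    {s : R} (hM : ∀ i, TrivialTorsionRelations s (M i)) : TrivialTorsionRelations s L := by
  intro n r x hx hrx
  obtain ⟨i, z, hz⟩ := h.exists_rep_of_finite x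
  obtain ⟨j, hij, hj⟩ := h.exists_eq_zero_of_finite (κ := Option (Fin n))
    (fun k => k.elim (∑ k, r k • z k) (fun k => s • z k)) (by
      rintro (_ | k)
      · simp [hz, hrx]
      · simp [hz, hx])
  obtain ⟨m, y, a, hy, hxy, ha⟩ := hM j n r (fun k => f i j hij (z k))
    (fun k => by rw [← map_smul]; exact hj (some k))
    (by simp only [← map_smul]; rw [← map_sum]; exact hj none)
  refine ⟨m, fun k => g j (y k), a, fun k => by rw [← map_smul, hy, map_zero], fun k => ?_, ha⟩
  have := congrArg (g j) (hxy k)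
  rw [h.compat, hz] at this
  simpa using this

lemma TrivialTorsionRelations.torsion' {s : R} {M : Type u} [AddCommGroup M] [Module R M]
    (h : TrivialTorsionRelations s M) {S : Submonoid R} (hs : s ∈ S) :
    TrivialTorsionRelations s (Submodule.torsion' R M S) := by
  intro n r x hx hrx
  obtain ⟨m, y, a, hy, hxy, ha⟩ := h n r (fun i => x i)
    (fun i => congrArg Subtype.val (hx i)) (by simpa using congrArg Subtype.val hrx)
  exact ⟨m, fun j => ⟨y j, ⟨s, hs⟩, hy j⟩, a, fun j => Subtype.ext (hy j),
    fun i => Subtype.ext (by simp [hxy]), ha⟩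

lemma TrivialTorsionRelations.of_flat_ker {s : R} {F K X : Type u} [AddCommGroup F] [Module R F]
    [AddCommGroup K] [Module R K] [AddCommGroup X] [Module R X] [Module.Flat R K]
    (k : K →ₗ[R] F) (p : F →ₗ[R] X) (hk : Function.Injective k) (hp : Function.Surjective p)
    (hkp : Function.Exact k p) (g : F →ₗ[R] F) (hg : ∀ x, s • p (g x) = p x) :
    TrivialTorsionRelations s X := by
  intro n r x hx hrx
  choose z hz using fun i => hp (x i)
  choose κ hκ using fun i => (hkp (s • z i)).1 (by rw [map_smul, hz, hx])
  obtain ⟨κ₀, hκ₀⟩ := (hkp (∑ i, r i • z i)).1 (by simp [hz, hrx])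
  have hrel : ∑ o : Option (Fin n), (o.elim (-s) r : R) • (o.elim κ₀ κ : K) = 0 := by
    refine hk ?_
    simp only [Fintype.sum_option, Option.elim, map_add, map_sum, map_smul, map_neg, hκ, hκ₀,
      map_zero, Finset.smul_sum, neg_smul, smul_comm s, neg_add_cancel]
  obtain ⟨m, a, y, h1, h2⟩ := Module.Flat.isTrivialRelation_of_sum_smul_eq_zero hrel
  refine ⟨m, fun j => p (g (k (y j))), fun i => a (some i), fun j => ?_, fun i => ?_, fun j => ?_⟩
  · rw [hg, hkp.apply_apply_eq_zero]
  · have h3 : p (g (k (κ i))) = ∑ j, a (some i) j • p (g (k (y j))) := by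
      rw [show κ i = ∑ j, a (some i) j • y j from h1 (some i)]
      simp
    rw [← h3, hκ, map_smul, map_smul, hg, hz]
  · have h3 := h2 j
    simp only [Fintype.sum_option, Option.elim] at h3
    exact ⟨a none j, by linear_combination h3⟩

namespace GabrielTopology

variable {G : GabrielTopology R}

lemma MemA.trivialTorsionRelations (hG : G.IsTiltingTopology) {X : Type u} [AddCommGroup X]
    [Module R X] (hX : G.MemA X) (hD : G.IsDivisible X) {s : R} (hs : s ∈ G.denominators) :
    TrivialTorsionRelations s X := by
  obtain ⟨F, _, _, _, p, hp⟩ : ∃ (F : Type u) (_ : AddCommGroup F) (_ : Module R F)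
      (_ : Module.Projective R F) (p : F →ₗ[R] X), Function.Surjective p :=
    ⟨X →₀ R, _, _, inferInstance, _, Finsupp.linearCombination_id_surjective R X⟩
  obtain ⟨K, _, _, k, hk, hkp⟩ : ∃ (K : Type u) (_ : AddCommGroup K) (_ : Module R K)
      (k : K →ₗ[R] F), Function.Injective k ∧ Function.Exact k p :=
    ⟨LinearMap.ker p, _, _, _, Submodule.subtype_injective _, LinearMap.exact_subtype_ker_map p⟩
  have := hX.projective_of_exact hG k p hk hp hkp
  obtain ⟨g, hg⟩ := Module.projective_lifting_property (s • p) p (fun x => by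
    obtain ⟨y, rfl⟩ := hD.exists_smul_eq hs x
    obtain ⟨z, rfl⟩ := hp y
    exact ⟨z, rfl⟩)
  exact .of_flat_ker k p hk hp hkp g fun x => LinearMap.congr_fun hg x

lemma IsTorsionFlat.torsion' {M : Type u} [AddCommGroup M] [Module R M] (hD : G.IsDivisible M)
    (h : ∀ s ∈ G.denominators, TrivialTorsionRelations s M) :
    G.IsTorsionFlat (Submodule.torsion' R M G.denominators) where
  divisible s hs := by
    rintro ⟨x, t, ht⟩
    obtain ⟨y, rfl⟩ := hD.exists_smul_eq hs x
    refine ⟨⟨y, t * ⟨s, hs⟩, ?_⟩, rfl⟩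
    rw [mul_smul]
    exact ht
  torsion := by
    rintro ⟨x, t, ht⟩
    exact ⟨t, t.2, Subtype.ext ht⟩
  relations s hs := (h s hs).torsion' hs

namespace IsRingOfQuotients

variable {Q : Type u} [CommRing Q] [Algebra R Q]

lemma isTorsionFlat (hQ : G.IsRingOfQuotients Q) (hF : G.Faithful) (hP : G.HasPrincipalBasis) :
    G.IsTorsionFlat (Q ⧸ LinearMap.range (Algebra.linearMap R Q)) := by
  have hloc := hQ.isLocalization hF hP
  have hinv : ∀ s ∈ G.denominators, ∃ v : Q, s • v = 1 := fun s hs => by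
    obtain ⟨v, hv⟩ := (IsLocalization.map_units Q (⟨s, hs⟩ : G.denominators)).exists_right_inv
    exact ⟨v, by rw [Algebra.smul_def]; exact hv⟩
  refine ⟨fun s hs x => ?_, fun x => ?_, fun s hs n r x hx hrx => ?_⟩
  · obtain ⟨v, hv⟩ := hinv s hs
    obtain ⟨q, rfl⟩ := Submodule.mkQ_surjective _ x
    exact ⟨Submodule.mkQ _ (v * q), by rw [← map_smul, ← smul_mul_assoc, hv, one_mul]⟩
  · obtain ⟨q, rfl⟩ := Submodule.mkQ_surjective _ x
    obtain ⟨J, hJ, h⟩ := hQ.coker_torsion q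
    obtain ⟨s, hsJ, hs⟩ := hP J hJ
    obtain ⟨r, hr⟩ := h s hsJ
    refine ⟨s, hs, ?_⟩
    rw [← map_smul]
    exact (Submodule.Quotient.mk_eq_zero _).2 ⟨r, hr.symm⟩
  · obtain ⟨v, hv⟩ := hinv s hs
    choose q hq using fun i => Submodule.mkQ_surjective _ (x i)
    have hc : ∀ i, ∃ c, algebraMap R Q c = s • q i := fun i => by
      have := hx i
      rw [← hq, ← map_smul] at this
      exact (Submodule.Quotient.mk_eq_zero _).1 this
    choose c hc using hc
    have hd : ∃ d, algebraMap R Q d = ∑ i, r i • q i := by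
      simp only [← hq, ← map_smul] at hrx
      rw [← map_sum] at hrx
      exact (Submodule.Quotient.mk_eq_zero _).1 hrx
    obtain ⟨d, hd⟩ := hd
    have hcq : ∀ i, c i • v = q i := fun i => by
      rw [Algebra.smul_def, hc, smul_mul_assoc, ← mul_smul_comm, hv, mul_one]
    refine ⟨1, fun _ => Submodule.mkQ _ v, fun i _ => c i, fun _ => ?_, fun i => ?_, fun _ => ?_⟩
    · rw [← map_smul, hv]
      exact (Submodule.Quotient.mk_eq_zero _).2 ⟨1, map_one (algebraMap R Q)⟩
    · rw [Fin.sum_univ_one, ← map_smul, hcq, hq]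
    · refine ⟨d, hQ.injective hF ?_⟩
      rw [map_mul, hd, map_sum, ← Algebra.smul_def, Finset.smul_sum]
      exact Finset.sum_congr rfl fun i _ => by
        rw [map_mul, hc, ← Algebra.smul_def, smul_comm]

theorem memA (hQ : G.IsRingOfQuotients Q) (hF : G.Faithful) (hP : G.HasPrincipalBasis)
    (hp : ∀ s ∈ G.denominators, IsPerfectRing (R ⧸ Ideal.span {s})) : G.MemA Q :=
  .extension (Algebra.linearMap R Q) (Submodule.mkQ (LinearMap.range (Algebra.linearMap R Q)))
    (Submodule.mkQ_surjective _) (LinearMap.exact_map_mkQ_range _) (hQ.injective hF) .self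
    ((hQ.isTorsionFlat hF hP).memA hp)

end IsRingOfQuotients

end GabrielTopology

end

section

open TensorProduct

variable {R : Type u} [CommRing R]

lemma IsModuleColimit.lTensor_localization {ι : Type u} [Preorder ι]
    {M : ι → Type u} [∀ i, AddCommGroup (M i)] [∀ i, Module R (M i)]
    {f : ∀ i j, i ≤ j → M i →ₗ[R] M j}
    {L : Type u} [AddCommGroup L] [Module R L] {g : ∀ i, M i →ₗ[R] L} (h : IsModuleColimit f g)
    (S : Submonoid R) (Q : Type u) [CommRing Q] [Algebra R Q] [IsLocalization S Q] :
    IsModuleColimit (fun i j hij => (f i j hij).lTensor Q) fun i => (g i).lTensor Q where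
  compat i j hij x := by
    rw [← LinearMap.lTensor_comp_apply]
    congr 2
    exact LinearMap.ext fun y => h.compat i j hij y
  exists_rep l := by
    obtain ⟨⟨m, s⟩, hm⟩ := IsLocalizedModule.surj S (TensorProduct.mk R Q L 1) l
    obtain ⟨i, x, rfl⟩ := h.exists_rep m
    refine ⟨i, IsLocalization.mk' Q 1 s ⊗ₜ x, ?_⟩
    refine IsLocalizedModule.smul_injective (TensorProduct.mk R Q L 1) s ?_
    change s • _ = s • _
    rw [hm, Submonoid.smul_def, ← map_smul, smul_tmul', LinearMap.lTensor_tmul,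
      IsLocalization.smul_mk', mul_one, IsLocalization.mk'_self', TensorProduct.mk_apply]
  exists_eq_zero i x hx := by
    obtain ⟨⟨m, s⟩, hm⟩ := IsLocalizedModule.surj S (TensorProduct.mk R Q (M i) 1) x
    have h1 : TensorProduct.mk R Q L 1 (g i m) = 0 := by
      have := congrArg ((g i).lTensor Q) hm
      rw [Submonoid.smul_def, map_smul, hx, smul_zero] at this
      exact this.symm
    obtain ⟨c, hc⟩ := (IsLocalizedModule.eq_zero_iff S _).1 h1
    rw [Submonoid.smul_def, ← map_smul] at hc
    obtain ⟨j, hij, hj⟩ := h.exists_eq_zero i _ hc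
    refine ⟨j, hij, ?_⟩
    refine IsLocalizedModule.smul_injective (TensorProduct.mk R Q (M j) 1) (c * s) ?_
    change (c * s) • _ = (c * s) • _
    rw [smul_zero, mul_smul, Submonoid.smul_def, Submonoid.smul_def, ← map_smul, ← map_smul]
    rw [Submonoid.smul_def] at hm
    rw [hm, ← map_smul, TensorProduct.mk_apply, LinearMap.lTensor_tmul, hj,
      TensorProduct.tmul_zero]

namespace GabrielTopology

variable {G : GabrielTopology R}

lemma HasPrincipalBasis.isDivisible_of_isLocalization (hP : G.HasPrincipalBasis)
    (Q : Type u) [CommRing Q] [Algebra R Q] [IsLocalization G.denominators Q] (N : Type u)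
    [AddCommGroup N] [Module R N] [Module Q N] [IsScalarTower R Q N] : G.IsDivisible N :=
  hP.isDivisible fun s hs x =>
    ⟨IsLocalization.mk' Q 1 (⟨s, hs⟩ : G.denominators) • x, by
      rw [← smul_assoc, IsLocalization.smul_mk', mul_one,
        IsLocalization.mk'_self Q hs, one_smul]⟩

lemma MemA.flat_of_isLocalizedModule (hP : G.HasPrincipalBasis) (Q : Type u) [CommRing Q]
    [Algebra R Q] [IsLocalization G.denominators Q] {X Y : Type u} [AddCommGroup X] [Module R X]
    [AddCommGroup Y] [Module R Y] [Module Q Y] [IsScalarTower R Q Y] (f : X →ₗ[R] Y)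
    [IsLocalizedModule G.denominators f] (hX : G.MemA X) : Module.Flat R Y := by
  set p : (Y →₀ Q) →ₗ[Q] Y := Finsupp.linearCombination Q id
  have hp : Function.Surjective p := Finsupp.linearCombination_id_surjective Q Y
  obtain ⟨g, hg⟩ := (hX _ (hP.isDivisible_of_isLocalization Q (LinearMap.ker p))).lift
    ((LinearMap.ker p).subtype.restrictScalars R) (p.restrictScalars R)
    (Submodule.subtype_injective _) (LinearMap.exact_subtype_ker_map p) f fun x => hp _
  have hid := isLocalizedModule_id G.denominators (Y →₀ Q) Q
  have := IsLocalization.flat Q G.denominators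
  have := Module.Flat.trans R Q (Y →₀ Q)
  refine Module.Flat.of_retract
    (IsLocalizedModule.lift G.denominators f g (IsLocalizedModule.map_units LinearMap.id))
    (p.restrictScalars R) ?_
  have := isLocalizedModule_id G.denominators Y Q
  refine IsLocalizedModule.linearMap_ext G.denominators f LinearMap.id (LinearMap.ext fun x => ?_)
  simpa using hg x

theorem aClosedUnderDirectLimits_of_isPerfectRing (hG : G.IsTiltingTopology)
    (hP : G.HasPrincipalBasis) {Q : Type u} [CommRing Q] [Algebra R Q]
    (hQ : G.IsRingOfQuotients Q) (hQp : IsPerfectRing Q)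
    (hp : ∀ s ∈ G.denominators, IsPerfectRing (R ⧸ Ideal.span {s})) :
    G.AClosedUnderDirectLimits := by
  have hloc := hQ.isLocalization hG.1 hP
  refine hG.aClosedUnderDirectLimits_of_divisible fun ι _ _ _ _ M _ _ f _ hA hD => ?_
  have hM := Module.DirectLimit.isModuleColimit (f := f)
  obtain ⟨L, _, _, g, hM', ⟨e⟩⟩ : ∃ (L : Type u) (_ : AddCommGroup L) (_ : Module R L)
      (g : ∀ i, M i →ₗ[R] L), IsModuleColimit f g ∧ Nonempty (L ≃ₗ[R] Module.DirectLimit M f) :=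
    ⟨_, _, _, _, hM, ⟨.refl R _⟩⟩
  refine MemA.of_linearEquiv ?_ e
  have hLD : G.IsDivisible L := hP.isDivisible fun s hs x => by
    obtain ⟨i, x, rfl⟩ := hM'.exists_rep x
    obtain ⟨y, rfl⟩ := (hD i).exists_smul_eq hs x
    exact ⟨g i y, (map_smul _ s y).symm⟩
  have htors := (IsTorsionFlat.torsion' hLD fun s hs =>
    .of_isModuleColimit hM' fun i => (hA i).trivialTorsionRelations hG (hD i) hs).memA hp
  have hflat : Module.Flat R (Q ⊗[R] L) := (hM'.lTensor_localization G.denominators Q).flat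
    fun i => (hA i).flat_of_isLocalizedModule hP Q (TensorProduct.mk R Q (M i) 1)
  have hflatQ := (Module.flat_iff_of_isLocalization Q G.denominators (M := Q ⊗[R] L)).2 hflat
  obtain ⟨σ, hσ⟩ := (hQp _ hflatQ).out
  have hloc : G.MemA (Q ⊗[R] L) := ((hQ.memA hG.1 hP hp).finsupp (ι := Q ⊗[R] L)).of_retract
    (σ.restrictScalars R) ((Finsupp.linearCombination Q id).restrictScalars R) hσ
  refine .extension (Submodule.subtype (Submodule.torsion' R L G.denominators))
    (TensorProduct.mk R Q L 1) (fun y => ?_) (fun x => ?_) (Submodule.subtype_injective _) htors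
    hloc
  · obtain ⟨⟨m, s⟩, hm⟩ := IsLocalizedModule.surj G.denominators (TensorProduct.mk R Q L 1) y
    obtain ⟨x, rfl⟩ := hLD.exists_smul_eq s.2 m
    refine ⟨x, IsLocalizedModule.smul_injective (TensorProduct.mk R Q L 1) s ?_⟩
    exact (map_smul _ (s : R) x).symm.trans hm.symm
  · refine (IsLocalizedModule.eq_zero_iff G.denominators _).trans ⟨fun hx => ⟨⟨x, hx⟩, rfl⟩, ?_⟩
    rintro ⟨x, rfl⟩
    exact x.2

end GabrielTopology

end

namespace GabrielTopology

variable {R : Type u} [CommRing R] {G : GabrielTopology R}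

namespace AClosedUnderDirectLimits

variable {Q : Type u} [CommRing Q] [Algebra R Q]

lemma productChainCondition_localization (hcl : G.AClosedUnderDirectLimits)
    (hP : G.HasPrincipalBasis) [IsLocalization G.denominators Q] : ProductChainCondition Q := by
  intro a
  choose z hz using fun k => IsLocalization.surj G.denominators (a k)
  obtain ⟨n, w, h⟩ := hcl.exists_prod_smul_eq .self
    (hP.isDivisible_of_isLocalization Q Q) (fun k => (z k).1) (Algebra.linearMap R Q) 1
  obtain ⟨u, hu⟩ := (IsLocalization.map_units Q
    (∏ k ∈ Finset.range n, (z k).2)).exists_right_inv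
  simp only [Algebra.smul_def, map_prod, ← hz, Finset.prod_mul_distrib, Algebra.linearMap_apply,
    map_one, mul_one] at h
  simp only [Submonoid.coe_finsetProd, map_prod] at hu
  refine ⟨n, (∏ k ∈ Finset.range (n + 1), algebraMap R Q (z k).2) * w 1 * u, ?_⟩
  linear_combination u * h - (∏ k ∈ Finset.range n, a k) * hu

lemma productChainCondition_quotient (hcl : G.AClosedUnderDirectLimits) (hF : G.Faithful)
    (hP : G.HasPrincipalBasis) (hQ : G.IsRingOfQuotients Q) {s : R} (hs : s ∈ G.denominators) :
    ProductChainCondition (R ⧸ Ideal.span {s}) := by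
  intro a
  have hloc := hQ.isLocalization hF hP
  choose b hb using fun k => Ideal.Quotient.mk_surjective (a k)
  obtain ⟨v, hv⟩ := (IsLocalization.map_units Q (⟨s, hs⟩ : G.denominators)).exists_right_inv
  have hv' : s • v = 1 := by rw [Algebra.smul_def]; exact hv
  obtain ⟨E, _, _, π, hπ, hEπ⟩ : ∃ (E : Type u) (_ : AddCommGroup E) (_ : Module R E)
      (π : Q →ₗ[R] E), Function.Surjective π ∧ Function.Exact (Algebra.linearMap R Q) π :=
    ⟨Q ⧸ LinearMap.range (Algebra.linearMap R Q), _, _, _, Submodule.mkQ_surjective _,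
      LinearMap.exact_map_mkQ_range _⟩
  have h1 : π 1 = 0 := (hEπ 1).2 ⟨1, map_one (algebraMap R Q)⟩
  obtain ⟨g, hg⟩ := LinearMap.exists_comp_eq_of_surjective (Submodule.mkQ (Ideal.span {s}))
    (Submodule.mkQ_surjective _) (π ∘ₗ LinearMap.toSpanSingleton R Q v) fun x hx => by
      obtain ⟨c, rfl⟩ := Ideal.mem_span_singleton.1
        ((Submodule.Quotient.mk_eq_zero (Ideal.span {s})).1 hx)
      rw [LinearMap.comp_apply, LinearMap.toSpanSingleton_apply, mul_comm, mul_smul, hv', map_smul,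
        h1, smul_zero]
  obtain ⟨n, w, h⟩ := hcl.exists_prod_smul_eq (MemA.quotient_span_singleton hs)
    ((hP.isDivisible_of_isLocalization Q Q).of_surjective π hπ) b g
    (Submodule.mkQ (Ideal.span {s}) 1)
  obtain ⟨q, hq⟩ := hπ (w (Submodule.mkQ (Ideal.span {s}) 1))
  have hsq : π (s • q) = 0 := by
    rw [map_smul, hq, ← map_smul, ← map_smul]
    refine (congrArg w ((Submodule.Quotient.mk_eq_zero _).2 ?_)).trans (map_zero w)
    exact Ideal.mul_mem_right _ _ (Ideal.mem_span_singleton_self s)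
  obtain ⟨c, hc⟩ := (hEπ _).1 hsq
  rw [hg, ← hq, LinearMap.comp_apply, LinearMap.toSpanSingleton_apply, one_smul, ← map_smul,
    ← map_smul, ← sub_eq_zero, ← map_sub] at h
  obtain ⟨d, hd⟩ := (hEπ _).1 h
  refine ⟨n, Ideal.Quotient.mk _ c, ?_⟩
  have key : ∏ k ∈ Finset.range n, b k = (∏ k ∈ Finset.range (n + 1), b k) * c + s * d := by
    refine hQ.injective hF ?_
    have h2 := congrArg (s • ·) hd
    simp only [Algebra.linearMap_apply, smul_sub] at h2 hc
    rw [smul_comm s, smul_comm s, hv', ← hc, Algebra.smul_def, Algebra.smul_def,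
      Algebra.smul_def] at h2
    rw [map_add, map_mul, map_mul]
    linear_combination -h2
  have hs0 : Ideal.Quotient.mk (Ideal.span {s}) s = 0 :=
    Ideal.Quotient.eq_zero_iff_mem.2 (Ideal.mem_span_singleton_self s)
  have := congrArg (Ideal.Quotient.mk (Ideal.span {s})) key
  simpa only [map_add, map_mul, map_prod, hb, hs0, zero_mul, add_zero] using this

end AClosedUnderDirectLimits

end GabrielTopology

theorem stmt0 (R : Type u) [CommRing R] (G : GabrielTopology R)
    (hG : G.IsTiltingTopology) :
    (G.IsACovering ↔ G.AClosedUnderDirectLimits) ∧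
    (G.IsACovering ↔
      ((∀ (Q : Type u) [CommRing Q] [Algebra R Q], G.IsRingOfQuotients Q → IsPerfectRing Q) ∧
       (∀ J ∈ G.sets, IsPerfectRing (R ⧸ J)))) ∧
    (G.IsACovering →
      ∀ (Q : Type u) [CommRing Q] [Algebra R Q], G.IsRingOfQuotients Q →
        G.IsPerfectLocalization Q ∧ ProjDimLE1 R Q) := by
  obtain ⟨hF, hfg, -⟩ := id hG
  have hcov : G.IsACovering ↔ G.AClosedUnderDirectLimits :=
    ⟨fun h => h.aClosedUnderDirectLimits hG, fun h => h.isACovering hG⟩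
  have hprin : G.AClosedUnderDirectLimits → G.HasPrincipalBasis := fun hcl =>
    (hcl.torsionProductChainCondition hfg).hasPrincipalBasis hfg
  have hquot : G.AClosedUnderDirectLimits → ∀ J ∈ G.sets, IsPerfectRing (R ⧸ J) := by
    intro hcl J hJ
    obtain ⟨s, hsJ, hs⟩ := hprin hcl J hJ
    have hs' := hcl.productChainCondition_quotient hF (hprin hcl) hfg.isRingOfQuotients hs
    exact (hs'.of_surjective
      (Ideal.Quotient.factor ((Ideal.span_singleton_le_iff_mem J).2 hsJ))
      (Ideal.Quotient.factor_surjective _)).isPerfectRing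
  refine ⟨hcov, hcov.trans ⟨fun hcl => ⟨fun Q _ _ hQ => ?_, hquot hcl⟩, fun ⟨hQp, hp⟩ => ?_⟩,
    fun h Q _ _ hQ => ?_⟩
  · have := hQ.isLocalization hF (hprin hcl)
    exact (hcl.productChainCondition_localization (hprin hcl)).isPerfectRing
  · have hQ := hfg.isRingOfQuotients
    have hP := (hQ.torsionProductChainCondition hF (hQp _ hQ)).hasPrincipalBasis hfg
    exact GabrielTopology.aClosedUnderDirectLimits_of_isPerfectRing hG hP hQ (hQp _ hQ)
      fun s hs => hp _ hs
  · have hcl := hcov.1 h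
    exact ⟨hQ.isPerfectLocalization hF (hprin hcl),
      (hQ.memA hF (hprin hcl) fun s hs => hquot hcl _ hs).projDimLE1 hG⟩
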